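/- arXiv:2604.19910 — 5 statements merged into one kernel-verified Lean document; each statement's English description precedes it below -/
import Mathlib

section
/- Let φ : ℝ → (−∞,+∞] be proper, even, convex, lower semicontinuous, differentiable on the interior of its domain, with φ(ξ) = 0 if and only if ξ = 0, and satisfying either (i) dom φ = ℝ with φ′(ξ) → ±∞ as ξ → ±∞, or (ii) dom φ = [−a, a] for some a > 0 with φ′(ξ) → ±∞ as ξ → ±a. Let F : ℝ → (−∞,+∞] be lower semicontinuous and convex with interior of dom F equal to (0,+∞), F differentiable on (0,+∞), and L₀ := lim_{ξ↓0} F′(ξ) existing in ℝ ∪ {−∞}. Fix γ > 0, ρ ∈ ℝ, m ∈ ℝ^d, and define R(t) = t + γF′(t) − ρ − γφ*(Prox_{(t/γ)φ*}(|m|/γ)) for t > 0. Then R is continuous and strictly increasing on (0,+∞), R(t) → +∞ as t → +∞, and R(t) → γL₀ − ρ − γφ*(|m|/γ) as t ↓ 0 (with the limit equal to −∞ when L₀ = −∞). -/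
open Filter Topology

-- Fenchel conjugate of an extended-real-valued function on ℝ.
noncomputable def fconj (φ : ℝ → EReal) (s : ℝ) : EReal :=
  ⨆ ξ : ℝ, ((s * ξ : ℝ) : EReal) - φ ξ

-- `IsProx1 f x p` : `p` is a minimizer of `y ↦ f y + (1/2)(y - x)²`.
def IsProx1 (f : ℝ → EReal) (x p : ℝ) : Prop :=
  ∀ y : ℝ, f p + (((1/2) * (p - x)^2 : ℝ) : EReal) ≤ f y + (((1/2) * (y - x)^2 : ℝ) : EReal)

theorem aux_toReal_convex (F : ℝ → EReal) (hFbot : ∀ x, F x ≠ ⊥) (S : Set ℝ) (hS : Convex ℝ S)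
    (hfin : ∀ x ∈ S, F x ≠ ⊤)
    (hFconv : ∀ x y t : ℝ, 0 ≤ t → t ≤ 1 →
      F (t * x + (1 - t) * y) ≤ (t : EReal) * F x + ((1 - t : ℝ) : EReal) * F y) :
    ConvexOn ℝ S (fun y => (F y).toReal) := by
  refine ⟨hS, ?_⟩
  intro x hx y hy a b ha hb hab
  have hz : a • x + b • y ∈ S := hS hx hy ha hb hab
  obtain rfl : b = 1 - a := by linarith
  have h := hFconv x y a ha (by linarith)
  simp only [smul_eq_mul] at hz ⊢
  rw [← EReal.coe_toReal (hfin x hx) (hFbot x), ← EReal.coe_toReal (hfin y hy) (hFbot y),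
    ← EReal.coe_toReal (hfin _ hz) (hFbot _)] at h
  exact_mod_cast h

theorem aux_deriv_cont (f f' : ℝ → ℝ) (hc : ConvexOn ℝ (Set.Ioi 0) f)
    (hd : ∀ x, 0 < x → HasDerivAt f (f' x) x) :
    MonotoneOn f' (Set.Ioi 0) ∧ ContinuousOn f' (Set.Ioi 0) := by
  have hmono : MonotoneOn f' (Set.Ioi 0) := by
    have := hc.monotoneOn_deriv (fun x hx => (hd x hx).differentiableAt)
    intro x hx y hy hxy
    have h := this hx hy hxy
    rwa [(hd x hx).deriv, (hd y hy).deriv] at h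
  refine ⟨hmono, ?_⟩
  have hs : StrictMonoOn (fun x => f' x + x) (Set.Ioi 0) := by
    intro x hx y hy hxy
    have := hmono hx hy hxy.le
    simp only; linarith
  have ho : Set.OrdConnected ((fun x => f' x + x) '' Set.Ioi 0) := by
    refine Set.ordConnected_Ioi.image_hasDerivWithinAt (f := fun x => f x + x ^ 2 / 2) ?_
    intro x hx
    have h2 : HasDerivAt (fun x : ℝ => x ^ 2 / 2) x x := by
      have := (hasDerivAt_pow 2 x).div_const 2
      simpa using this
    exact ((hd x hx).add h2).hasDerivWithinAt
  have hcont : ContinuousOn (fun x => f' x + x) (Set.Ioi 0) := by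
    intro a ha
    have ha' : (0:ℝ) < a := ha
    refine (hs.continuousAt_of_exists_between (Ioi_mem_nhds ha') ?_ ?_).continuousWithinAt
    · intro b hb
      have h1 : a / 2 ∈ Set.Ioi (0:ℝ) := half_pos ha'
      have h2 := hs h1 ha (half_lt_self ha')
      by_cases h : b ≤ f' (a/2) + a/2
      · exact ⟨a/2, h1, h, h2⟩
      · obtain ⟨c, hc1, hc2⟩ := ho.out ⟨_, h1, rfl⟩ ⟨_, ha, rfl⟩ ⟨(not_le.1 h).le, hb.le⟩
        exact ⟨c, hc1, hc2.ge, hc2.trans_lt hb⟩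
    · intro b hb
      have h1 : a + 1 ∈ Set.Ioi (0:ℝ) := by simp; linarith
      have h2 := hs ha h1 (lt_add_one a)
      by_cases h : f' (a+1) + (a+1) ≤ b
      · exact ⟨a+1, h1, h2, h⟩
      · obtain ⟨c, hc1, hc2⟩ := ho.out ⟨_, ha, rfl⟩ ⟨_, h1, rfl⟩ ⟨hb.le, (not_le.1 h).le⟩
        exact ⟨c, hc1, lt_of_lt_of_eq hb hc2.symm, hc2.le⟩
  have := hcont.sub continuousOn_id
  refine this.congr ?_
  intro x _
  simp

theorem aux_sq_tendsto {l : Filter ℝ} (P u : ℝ → ℝ) (p : ℝ) (h : ∀ᶠ s in l, (P s - p) ^ 2 ≤ u s)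
    (hu : Tendsto u l (𝓝 0)) : Tendsto P l (𝓝 p) := by
  rw [tendsto_iff_dist_tendsto_zero]
  have h2 : Tendsto (fun s => √(u s)) l (𝓝 0) := by
    have := (Real.continuous_sqrt.tendsto 0).comp hu
    simpa [Function.comp_def] using this
  refine tendsto_of_tendsto_of_tendsto_of_le_of_le' tendsto_const_nhds h2
    (Eventually.of_forall fun _ => dist_nonneg) ?_
  filter_upwards [h] with s hs
  rw [Real.dist_eq]
  exact Real.abs_le_sqrt hs

/-- The conjugate is real-valued, nonnegative, convex. -/
theorem aux_conj (φ : ℝ → EReal) (φ' : ℝ → ℝ)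
    (hbot : ∀ x, φ x ≠ ⊥)
    (heven : ∀ x, φ (-x) = φ x)
    (hconv : ∀ x y t : ℝ, 0 ≤ t → t ≤ 1 →
      φ (t * x + (1 - t) * y) ≤ (t : EReal) * φ x + ((1 - t : ℝ) : EReal) * φ y)
    (hdiff : ∀ x ∈ interior {x : ℝ | φ x ≠ ⊤}, HasDerivAt (fun y => (φ y).toReal) (φ' x) x)
    (hzero : ∀ x, φ x = 0 ↔ x = 0)
    (hcase :
      ({x : ℝ | φ x ≠ ⊤} = Set.univ ∧ Tendsto φ' atBot atBot ∧ Tendsto φ' atTop atTop) ∨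
      (∃ a : ℝ, 0 < a ∧ {x : ℝ | φ x ≠ ⊤} = Set.Icc (-a) a ∧
        Tendsto φ' (𝓝[>] (-a)) atBot ∧ Tendsto φ' (𝓝[<] a) atTop)) :
    ∃ G : ℝ → ℝ, (∀ s, fconj φ s = (G s : EReal)) ∧ (∀ s, 0 ≤ G s) ∧ ConvexOn ℝ Set.univ G := by
  have h0 : φ 0 = 0 := (hzero 0).2 rfl
  have hf : ∀ x, φ x ≠ ⊤ → ((φ x).toReal : EReal) = φ x := fun x hx =>
    EReal.coe_toReal hx (hbot x)
  have hnn : ∀ x, φ x ≠ ⊤ → 0 ≤ (φ x).toReal := by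
    intro x hx
    have h := hconv x (-x) (1/2) (by norm_num) (by norm_num)
    rw [heven, show (1/2 : ℝ) * x + (1 - 1/2) * (-x) = 0 by ring, h0, ← hf x hx] at h
    have h' : (0:ℝ) ≤ (1/2) * (φ x).toReal + (1 - 1/2) * (φ x).toReal := by exact_mod_cast h
    linarith
  have hle : ∀ s ξ, φ ξ ≠ ⊤ → ((s * ξ - (φ ξ).toReal : ℝ) : EReal) ≤ fconj φ s := by
    intro s ξ hξ
    have := le_iSup (fun ξ : ℝ => ((s * ξ : ℝ) : EReal) - φ ξ) ξ
    rw [EReal.coe_sub, hf ξ hξ]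
    exact this
  have hge : ∀ s (c : ℝ), (∀ ξ, φ ξ ≠ ⊤ → s * ξ - (φ ξ).toReal ≤ c) → fconj φ s ≤ (c : EReal) := by
    intro s c h
    refine iSup_le fun ξ => ?_
    by_cases hξ : φ ξ = ⊤
    · rw [hξ]; simp
    · rw [← hf ξ hξ, ← EReal.coe_sub]
      exact_mod_cast h ξ hξ
  have hbd : ∀ s, ∃ c : ℝ, ∀ ξ, φ ξ ≠ ⊤ → s * ξ - (φ ξ).toReal ≤ c := by
    intro s
    rcases hcase with ⟨hdom, -, htop⟩ | ⟨a, ha, hdom, -, -⟩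
    · have hdom' : ∀ x, φ x ≠ ⊤ := fun x => by
        have : x ∈ {x : ℝ | φ x ≠ ⊤} := hdom ▸ Set.mem_univ x
        exact this
      have hd : ∀ x, HasDerivAt (fun y => (φ y).toReal) (φ' x) x := fun x =>
        hdiff x (by rw [hdom]; simp)
      obtain ⟨b, hb0, hb⟩ : ∃ b, 0 ≤ b ∧ ∀ x, b ≤ x → |s| ≤ φ' x := by
        obtain ⟨b, hb⟩ := eventually_atTop.1 (htop.eventually_ge_atTop |s|)
        exact ⟨max b 0, le_max_right _ _, fun x hx => hb x ((le_max_left _ _).trans hx)⟩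
      have hd2 : ∀ x, HasDerivAt (fun y => (φ y).toReal - |s| * y) (φ' x - |s|) x := fun x => by
        have h1 : HasDerivAt (fun y => |s| * y) |s| x := by
          simpa using (hasDerivAt_id x).const_mul |s|
        exact (hd x).sub h1
      have hmono : MonotoneOn (fun y => (φ y).toReal - |s| * y) (Set.Ici b) := by
        refine monotoneOn_of_deriv_nonneg (convex_Ici b) ?_ ?_ ?_
        · exact fun x _ => (hd2 x).continuousAt.continuousWithinAt
        · exact fun x _ => (hd2 x).differentiableAt.differentiableWithinAt
        · intro x hx
          rw [interior_Ici] at hx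
          rw [(hd2 x).deriv]
          linarith [hb x (le_of_lt hx)]
      have key : ∀ x, 0 ≤ x → |s| * x - (φ x).toReal ≤ |s| * b := by
        intro x hx
        rcases le_total x b with h | h
        · have := mul_le_mul_of_nonneg_left h (abs_nonneg s)
          linarith [hnn x (hdom' x)]
        · have := hmono (Set.mem_Ici.2 le_rfl) (Set.mem_Ici.2 h) h
          simp only at this
          linarith [hnn b (hdom' b)]
      refine ⟨|s| * b, fun ξ _ => ?_⟩
      have h1 : (φ |ξ|).toReal = (φ ξ).toReal := by
        rcases abs_choice ξ with h | h <;> rw [h]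
        rw [heven]
      have h2 := key |ξ| (abs_nonneg _)
      rw [h1] at h2
      have h3 : s * ξ ≤ |s| * |ξ| := by rw [← abs_mul]; exact le_abs_self _
      linarith
    · refine ⟨|s| * a, fun ξ hξ => ?_⟩
      have hξ' : ξ ∈ Set.Icc (-a) a := hdom ▸ hξ
      have h3 : s * ξ ≤ |s| * |ξ| := by rw [← abs_mul]; exact le_abs_self _
      have h4 := mul_le_mul_of_nonneg_left (abs_le.2 hξ') (abs_nonneg s)
      linarith [hnn ξ hξ]
  have hz : ∀ s, (0 : EReal) ≤ fconj φ s := by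
    intro s
    have := hle s 0 (by rw [h0]; simp)
    simpa [h0] using this
  have hG : ∀ s, fconj φ s = ((fconj φ s).toReal : EReal) := by
    intro s
    obtain ⟨c, hc⟩ := hbd s
    refine (EReal.coe_toReal ?_ ?_).symm
    · exact ((hge s c hc).trans_lt (EReal.coe_lt_top c)).ne
    · exact (lt_of_lt_of_le EReal.bot_lt_zero (hz s)).ne'
  refine ⟨fun s => (fconj φ s).toReal, hG, fun s => ?_, convex_univ, ?_⟩
  · have := hz s
    rw [hG s] at this
    exact_mod_cast this
  · intro x _ y _ a b ha hb hab
    have := hge (a • x + b • y) (a • (fconj φ x).toReal + b • (fconj φ y).toReal) ?_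
    · rw [hG] at this
      exact_mod_cast this
    · intro ξ hξ
      have h1 := hle x ξ hξ
      have h2 := hle y ξ hξ
      rw [hG] at h1 h2
      have h1' : x * ξ - (φ ξ).toReal ≤ (fconj φ x).toReal := by exact_mod_cast h1
      have h2' : y * ξ - (φ ξ).toReal ≤ (fconj φ y).toReal := by exact_mod_cast h2
      have h3 := mul_le_mul_of_nonneg_left h1' ha
      have h4 := mul_le_mul_of_nonneg_left h2' hb
      simp only [smul_eq_mul]
      have h5 : (φ ξ).toReal = a * (φ ξ).toReal + b * (φ ξ).toReal := by
        rw [← add_mul, hab, one_mul]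
      linarith

/-- the function `R(t) = t + γF′(t) − ρ − γφ*(Prox_{(t/γ)φ*}(|m|/γ))` is
continuous and strictly increasing on `(0,∞)`, tends to `+∞` at `+∞`, and tends to
`γL₀ − ρ − γφ*(|m|/γ)` as `t ↓ 0` (in the extended reals, the limit being `−∞` if `L₀ = −∞`). -/
theorem R_strictMono_continuous_limits
    (d : ℕ) (hd : 1 ≤ d)
    (φ : ℝ → EReal) (φ' : ℝ → ℝ)
    (hbot : ∀ x, φ x ≠ ⊥)
    (hproper : ∃ x, φ x ≠ ⊤)
    (heven : ∀ x, φ (-x) = φ x)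
    (hconv : ∀ x y t : ℝ, 0 ≤ t → t ≤ 1 →
      φ (t * x + (1 - t) * y) ≤ (t : EReal) * φ x + ((1 - t : ℝ) : EReal) * φ y)
    (hlsc : LowerSemicontinuous φ)
    (hdiff : ∀ x ∈ interior {x : ℝ | φ x ≠ ⊤}, HasDerivAt (fun y => (φ y).toReal) (φ' x) x)
    (hzero : ∀ x, φ x = 0 ↔ x = 0)
    (hcase :
      ({x : ℝ | φ x ≠ ⊤} = Set.univ ∧ Tendsto φ' atBot atBot ∧ Tendsto φ' atTop atTop) ∨
      (∃ a : ℝ, 0 < a ∧ {x : ℝ | φ x ≠ ⊤} = Set.Icc (-a) a ∧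
        Tendsto φ' (𝓝[>] (-a)) atBot ∧ Tendsto φ' (𝓝[<] a) atTop))
    (F : ℝ → EReal) (F' : ℝ → ℝ)
    (hFbot : ∀ x, F x ≠ ⊥)
    (hFlsc : LowerSemicontinuous F)
    (hFconv : ∀ x y t : ℝ, 0 ≤ t → t ≤ 1 →
      F (t * x + (1 - t) * y) ≤ (t : EReal) * F x + ((1 - t : ℝ) : EReal) * F y)
    (hFdom : interior {x : ℝ | F x ≠ ⊤} = Set.Ioi 0)
    (hFdiff : ∀ x : ℝ, 0 < x → HasDerivAt (fun y => (F y).toReal) (F' x) x)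
    (L₀ : EReal) (hL0top : L₀ ≠ ⊤)
    (hL0 : Tendsto (fun ξ : ℝ => (F' ξ : EReal)) (𝓝[>] 0) (𝓝 L₀))
    (γ : ℝ) (hγ : 0 < γ) (ρ : ℝ) (m : EuclideanSpace ℝ (Fin d))
    -- `P t = Prox_{(t/γ)φ*}(|m|/γ)` for `t > 0`
    (P : ℝ → ℝ)
    (hP : ∀ t : ℝ, 0 < t →
      IsProx1 (fun y => ((t / γ : ℝ) : EReal) * fconj φ y) (‖m‖ / γ) (P t))
    (R : ℝ → ℝ)
    (hR : ∀ t : ℝ, R t = t + γ * F' t - ρ - γ * (fconj φ (P t)).toReal) :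
    StrictMonoOn R (Set.Ioi 0) ∧
    ContinuousOn R (Set.Ioi 0) ∧
    Tendsto R atTop atTop ∧
    Tendsto (fun t : ℝ => ((R t : ℝ) : EReal)) (𝓝[>] 0)
      (𝓝 ((γ : EReal) * L₀ - (ρ : EReal) - (γ : EReal) * fconj φ (‖m‖ / γ))) := by
  obtain ⟨G, hG, hGnn, hGc⟩ := aux_conj φ φ' hbot heven hconv hdiff hzero hcase
  have hGcont : Continuous G := by
    have := hGc.continuousOn isOpen_univ
    exact continuousOn_univ.1 this
  have hFfin : ∀ x ∈ Set.Ioi (0:ℝ), F x ≠ ⊤ := by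
    intro x hx
    rw [← hFdom] at hx
    exact interior_subset hx
  obtain ⟨hF'mono, hF'cont⟩ := aux_deriv_cont _ F'
    (aux_toReal_convex F hFbot (Set.Ioi 0) (convex_Ioi 0) hFfin hFconv) hFdiff
  set x : ℝ := ‖m‖ / γ with hx
  have hR' : ∀ t, R t = t + γ * F' t - ρ - γ * G (P t) := by
    intro t; rw [hR, hG]; simp
  have hmin : ∀ t, 0 < t → ∀ y, t / γ * G (P t) + (1/2) * (P t - x)^2
      ≤ t / γ * G y + (1/2) * (y - x)^2 := by
    intro t ht y
    have h := hP t ht y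
    simp only [hG] at h
    exact_mod_cast h
  have hstrong : ∀ t, 0 < t → ∀ y, t / γ * G (P t) + (1/2) * (P t - x)^2 + (1/4) * (y - P t)^2
      ≤ t / γ * G y + (1/2) * (y - x)^2 := by
    intro t ht y
    have h1 := hmin t ht ((1/2) * P t + (1/2) * y)
    have h2 := hGc.2 (Set.mem_univ (P t)) (Set.mem_univ y)
      (by norm_num : (0:ℝ) ≤ 1/2) (by norm_num : (0:ℝ) ≤ 1/2) (by norm_num)
    simp only [smul_eq_mul] at h2
    have h3 := mul_le_mul_of_nonneg_left h2 (div_pos ht hγ).le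
    nlinarith
  have hdiff2 : ∀ s t, 0 < s → 0 < t →
      (1/2) * (P s - P t)^2 ≤ (t / γ - s / γ) * (G (P s) - G (P t)) := by
    intro s t hs ht
    have h1 := hstrong s hs (P t)
    have h2 := hstrong t ht (P s)
    nlinarith
  have hGanti : ∀ s t, 0 < s → s < t → G (P t) ≤ G (P s) := by
    intro s t hs hst
    have h := hdiff2 s t hs (hs.trans hst)
    have h1 : 0 < t / γ - s / γ := by
      rw [← sub_div]; exact div_pos (sub_pos.2 hst) hγ
    by_contra hcon
    have : (t / γ - s / γ) * (G (P s) - G (P t)) < 0 :=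
      mul_neg_of_pos_of_neg h1 (by linarith [not_le.1 hcon])
    nlinarith [sq_nonneg (P s - P t)]
  have hGle : ∀ t, 0 < t → G (P t) ≤ G x := by
    intro t ht
    have h := hmin t ht x
    have h1 : t / γ * G (P t) ≤ t / γ * G x := by nlinarith [sq_nonneg (P t - x)]
    exact le_of_mul_le_mul_left h1 (div_pos ht hγ)
  have hPcont : ContinuousOn P (Set.Ioi 0) := by
    intro t ht
    have ht' : 0 < t := ht
    refine aux_sq_tendsto P (fun s => 2 * (|t / γ - s / γ| * G x)) (P t) ?_ ?_
    · filter_upwards [self_mem_nhdsWithin] with s hs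
      have h := hdiff2 s t hs ht
      have h1 : (t / γ - s / γ) * (G (P s) - G (P t)) ≤ |t / γ - s / γ| * G x := by
        refine (le_abs_self _).trans ?_
        rw [abs_mul]
        refine mul_le_mul_of_nonneg_left ?_ (abs_nonneg _)
        rw [abs_le]
        constructor <;> linarith [hGle s hs, hGle t ht, hGnn (P s), hGnn (P t)]
      linarith
    · have hc : Continuous (fun s : ℝ => 2 * (|t / γ - s / γ| * G x)) := by fun_prop
      have := (hc.tendsto t).mono_left (nhdsWithin_le_nhds (s := Set.Ioi 0))
      simpa using this
  have hP0 : Tendsto P (𝓝[>] 0) (𝓝 x) := by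
    refine aux_sq_tendsto P (fun s => 2 * (s / γ * G x)) x ?_ ?_
    · filter_upwards [self_mem_nhdsWithin] with s hs
      have h := hmin s hs x
      have := mul_nonneg (div_pos hs hγ).le (hGnn (P s))
      nlinarith
    · have hc : Continuous (fun s : ℝ => 2 * (s / γ * G x)) := by fun_prop
      have := (hc.tendsto 0).mono_left (nhdsWithin_le_nhds (s := Set.Ioi 0))
      simpa using this
  have hG0 : Tendsto (fun t => G (P t)) (𝓝[>] 0) (𝓝 (G x)) := (hGcont.tendsto x).comp hP0
  have hid : Tendsto (fun t : ℝ => t) (𝓝[>] 0) (𝓝 0) := nhdsWithin_le_nhds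
  refine ⟨?_, ?_, ?_, ?_⟩
  · intro s hs t ht hst
    rw [hR', hR']
    have h1 := mul_le_mul_of_nonneg_left (hF'mono hs ht hst.le) hγ.le
    have h2 := mul_le_mul_of_nonneg_left (hGanti s t hs hst) hγ.le
    linarith
  · have hRe : R = fun t => t + γ * F' t - ρ - γ * G (P t) := funext hR'
    rw [hRe]
    have : ContinuousOn (fun t => G (P t)) (Set.Ioi 0) := hGcont.comp_continuousOn hPcont
    fun_prop
  · refine tendsto_atTop_mono' atTop ?_
      (tendsto_atTop_add_const_right atTop (γ * F' 1 - ρ - γ * G x) tendsto_id)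
    filter_upwards [eventually_ge_atTop 1] with t ht
    have ht0 : (0:ℝ) < t := by linarith
    rw [hR']
    have h1 := mul_le_mul_of_nonneg_left
      (hF'mono (Set.mem_Ioi.2 one_pos) (Set.mem_Ioi.2 ht0) ht) hγ.le
    have h2 := mul_le_mul_of_nonneg_left (hGle t ht0) hγ.le
    simp only [id]
    linarith
  · rw [hG]
    induction L₀ with
    | top => exact absurd rfl hL0top
    | bot =>
      rw [EReal.coe_mul_bot_of_pos hγ, EReal.bot_sub, EReal.bot_sub]
      have hb : Tendsto F' (𝓝[>] 0) atBot := by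
        rw [tendsto_atBot]
        intro b
        have := hL0.eventually (gt_mem_nhds (EReal.bot_lt_coe b))
        filter_upwards [this] with t ht
        exact (EReal.coe_lt_coe_iff.1 ht).le
      have hRb : Tendsto R (𝓝[>] 0) atBot := by
        have h1 : Tendsto (fun t => γ * F' t) (𝓝[>] 0) atBot := hb.const_mul_atBot hγ
        have h2 : Tendsto (fun t => t - ρ - γ * G (P t)) (𝓝[>] 0) (𝓝 (0 - ρ - γ * G x)) :=
          (hid.sub_const ρ).sub (hG0.const_mul γ)
        refine (h1.atBot_add h2).congr fun t => ?_
        rw [hR']; ring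
      exact EReal.tendsto_coe_nhds_bot_iff.2 hRb
    | coe L =>
      have hL : Tendsto F' (𝓝[>] 0) (𝓝 L) := EReal.tendsto_coe.1 hL0
      have h : Tendsto R (𝓝[>] 0) (𝓝 (γ * L - ρ - γ * G x)) := by
        have h1 := ((hid.add (hL.const_mul γ)).sub_const ρ).sub (hG0.const_mul γ)
        rw [zero_add] at h1
        exact h1.congr fun t => (hR' t).symm
      have := EReal.tendsto_coe.2 h
      simpa using this
end

section
/- Let φ : ℝ → (−∞,+∞] be proper, even, convex, lower semicontinuous, differentiable on the interior of its domain, with φ(ξ) = 0 if and only if ξ = 0, and satisfying either (i) dom φ = ℝ with φ′(ξ) → ±∞ as ξ → ±∞, or (ii) dom φ = [−a, a] for some a > 0 with φ′(ξ) → ±∞ as ξ → ±a. Let F : ℝ → (−∞,+∞] be lower semicontinuous and convex with interior of dom F equal to (0,+∞), F differentiable on (0,+∞), and L₀ := lim_{ξ↓0} F′(ξ) existing in ℝ ∪ {−∞}. Fix γ > 0, ρ ∈ ℝ, m ∈ ℝ^d, and suppose ρ + γφ*(|m|/γ) > γL₀. Then there exists a unique θ > 0 such that θ + γF′(θ) −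 ρ − γφ*(Prox_{(θ/γ)φ*}(|m|/γ)) = 0, and this θ satisfies Prox_{γF}ρ ≤ θ ≤ Prox_{γF}(ρ + γφ*(|m|/γ)). -/
open Filter Topology

lemma aux_convexOn (f : ℝ → EReal) (hbot : ∀ x, f x ≠ ⊥)
    (hconv : ∀ x y t : ℝ, 0 ≤ t → t ≤ 1 →
      f (t * x + (1 - t) * y) ≤ (t : EReal) * f x + ((1 - t : ℝ) : EReal) * f y) :
    ConvexOn ℝ {x : ℝ | f x ≠ ⊤} (fun x => (f x).toReal) := by
  have key : ∀ x, f x ≠ ⊤ → ∀ y, f y ≠ ⊤ → ∀ a b : ℝ, 0 ≤ a → 0 ≤ b → a + b = 1 →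
      f (a * x + b * y) ≤ ((a * (f x).toReal + b * (f y).toReal : ℝ) : EReal) := by
    intro x hx y hy a b ha hb hab
    have hb' : b = 1 - a := by linarith
    have h := hconv x y a ha (by linarith)
    rw [← hb'] at h
    rw [← EReal.coe_toReal hx (hbot x), ← EReal.coe_toReal hy (hbot y)] at h
    exact_mod_cast h
  refine ⟨?_, ?_⟩
  · intro x hx y hy a b ha hb hab
    have h := key x hx y hy a b ha hb hab
    simp only [smul_eq_mul, Set.mem_ofPred_eq]
    exact ne_top_of_le_ne_top (EReal.coe_ne_top _) h
  · intro x hx y hy a b ha hb hab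
    have h := key x hx y hy a b ha hb hab
    simp only [smul_eq_mul]
    have h2 := EReal.toReal_le_toReal h (hbot _) (EReal.coe_ne_top _)
    rwa [EReal.toReal_coe] at h2

lemma aux_tangent {D : Set ℝ} {f : ℝ → ℝ} (hf : ConvexOn ℝ D f) {x y f' : ℝ}
    (hx : x ∈ D) (hy : y ∈ D) (h : HasDerivAt f f' x) : f x + f' * (y - x) ≤ f y := by
  rcases lt_trichotomy x y with hxy | hxy | hxy
  · have := hf.le_slope_of_hasDerivAt hx hy hxy h
    rw [slope_def_field, le_div_iff₀ (by linarith)] at this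
    linarith
  · subst hxy; simp
  · have := hf.slope_le_of_hasDerivAt hy hx hxy h
    rw [slope_def_field, div_le_iff₀ (by linarith)] at this
    linarith

/-- real-valued conjugate facts -/
lemma aux_conj_s6 (φ : ℝ → EReal) (hbot : ∀ x, φ x ≠ ⊥) (h0 : φ 0 = 0)
    (hb : ∀ s : ℝ, ∃ C : ℝ, ∀ ξ, φ ξ ≠ ⊤ → s * ξ - (φ ξ).toReal ≤ C) :
    ∃ g : ℝ → ℝ, (∀ s, fconj φ s = (g s : EReal)) ∧ (∀ s, 0 ≤ g s) ∧
      ConvexOn ℝ Set.univ g := by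
  have hle : ∀ (s C : ℝ), (∀ ξ, φ ξ ≠ ⊤ → s * ξ - (φ ξ).toReal ≤ C) → fconj φ s ≤ (C : EReal) := by
    intro s C h
    refine iSup_le fun ξ => ?_
    by_cases hξ : φ ξ = ⊤
    · rw [hξ, EReal.sub_top]; exact bot_le
    · have := h ξ hξ
      rw [← EReal.coe_toReal hξ (hbot ξ)]
      exact_mod_cast this
  have hge : ∀ (s ξ : ℝ), φ ξ ≠ ⊤ → ((s * ξ - (φ ξ).toReal : ℝ) : EReal) ≤ fconj φ s := by
    intro s ξ hξ
    have h1 : ((s * ξ : ℝ) : EReal) - φ ξ ≤ fconj φ s :=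
      le_iSup (fun ξ : ℝ => ((s * ξ : ℝ) : EReal) - φ ξ) ξ
    rw [← EReal.coe_toReal hξ (hbot ξ)] at h1
    exact_mod_cast h1
  have hpos : ∀ s, (0 : EReal) ≤ fconj φ s := by
    intro s
    have := hge s 0 (by rw [h0]; simp)
    simpa [h0] using this
  have hcoe : ∀ s, fconj φ s = ((fconj φ s).toReal : EReal) := by
    intro s
    obtain ⟨C, hC⟩ := hb s
    refine (EReal.coe_toReal ?_ ?_).symm
    · exact ne_top_of_le_ne_top (EReal.coe_ne_top _) (hle s C hC)
    · exact ne_bot_of_le_ne_bot (by simp) (hpos s)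
  refine ⟨fun s => (fconj φ s).toReal, hcoe, fun s => EReal.toReal_nonneg (hpos s), convex_univ, ?_⟩
  intro x _ y _ a b ha hb' hab
  simp only [smul_eq_mul]
  have hgeR : ∀ s ξ : ℝ, φ ξ ≠ ⊤ → s * ξ - (φ ξ).toReal ≤ (fconj φ s).toReal := by
    intro s ξ hξ
    have := hge s ξ hξ
    rw [hcoe s] at this
    exact_mod_cast this
  have : fconj φ (a * x + b * y) ≤
      ((a * (fconj φ x).toReal + b * (fconj φ y).toReal : ℝ) : EReal) := by
    apply hle
    intro ξ hξ
    have h1 := mul_le_mul_of_nonneg_left (hgeR x ξ hξ) ha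
    have h2 := mul_le_mul_of_nonneg_left (hgeR y ξ hξ) hb'
    have h3 : (φ ξ).toReal = a * (φ ξ).toReal + b * (φ ξ).toReal := by
      rw [← add_mul, hab, one_mul]
    nlinarith
  rw [hcoe] at this
  exact_mod_cast this

lemma aux_prox {g : ℝ → ℝ} (hg : ConvexOn ℝ Set.univ g) {t x p : ℝ} (ht : 0 ≤ t)
    (hp : ∀ y, t * g p + (1/2) * (p - x)^2 ≤ t * g y + (1/2) * (y - x)^2) (y : ℝ) :
    t * g p + (1/2) * (p - x)^2 + (1/4) * (p - y)^2 ≤ t * g y + (1/2) * (y - x)^2 := by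
  have h1 := hp ((1/2) * p + (1/2) * y)
  have h2 := hg.2 (Set.mem_univ p) (Set.mem_univ y) (by norm_num : (0:ℝ) ≤ 1/2)
    (by norm_num : (0:ℝ) ≤ 1/2) (by norm_num)
  simp only [smul_eq_mul] at h2
  have h3 := mul_le_mul_of_nonneg_left h2 ht
  nlinarith

lemma aux_Gcont {g : ℝ → ℝ} (hg : ConvexOn ℝ Set.univ g) (hg0 : ∀ s, 0 ≤ g s)
    {γ x : ℝ} (hγ : 0 < γ) (P : ℝ → ℝ)
    (hP : ∀ t : ℝ, 0 < t → ∀ y, t / γ * g (P t) + (1/2) * (P t - x)^2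
      ≤ t / γ * g y + (1/2) * (y - x)^2) :
    ∃ G : ℝ → ℝ, Continuous G ∧ Antitone G ∧ G 0 = g x ∧ ∀ t, 0 < t → G t = g (P t) := by
  classical
  set Q : ℝ → ℝ := fun t => if 0 < t then P t else x with hQdef
  have hQ : ∀ t : ℝ, ∀ y, max t 0 / γ * g (Q t) + (1/2) * (Q t - x)^2
      ≤ max t 0 / γ * g y + (1/2) * (y - x)^2 := by
    intro t y
    by_cases ht : 0 < t
    · simp only [hQdef, if_pos ht, max_eq_left ht.le]; exact hP t ht y
    · simp only [hQdef, if_neg ht, max_eq_right (not_lt.mp ht)]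
      simp only [zero_div, zero_mul, sub_self, zero_add]
      nlinarith [sq_nonneg (y - x)]
  have hm : ∀ t : ℝ, 0 ≤ max t 0 / γ := fun t => div_nonneg (le_max_right _ _) hγ.le
  have hgle : ∀ t, g (Q t) ≤ g x := by
    intro t
    by_cases ht : 0 < t
    · have h := hQ t x
      rw [max_eq_left ht.le] at h
      have hp : 0 < t / γ := by positivity
      by_contra hc
      push Not at hc
      nlinarith [sq_nonneg (Q t - x), mul_lt_mul_of_pos_left hc hp]
    · simp [hQdef, if_neg ht]
  have hanti : Antitone (fun t => g (Q t)) := by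
    intro s t hst
    simp only
    by_cases ht : 0 < s
    · rcases hst.eq_or_lt with rfl | hst
      · exact le_rfl
      have h1 := hQ s (Q t)
      have h2 := hQ t (Q s)
      rw [max_eq_left ht.le] at h1
      rw [max_eq_left (ht.trans hst).le] at h2
      have h3 : s / γ < t / γ := by gcongr
      by_contra hc
      push Not at hc
      nlinarith
    · have : Q s = x := by simp [hQdef, if_neg ht]
      rw [this]; exact hgle t
  have hholder : ∀ s t, (Q s - Q t)^2 ≤ 2 * (|s - t| / γ * g x) := by
    intro s t
    have h1 := aux_prox hg (hm s) (hQ s) (Q t)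
    have h2 := aux_prox hg (hm t) (hQ t) (Q s)
    have h3 : (Q s - Q t)^2 ≤ 2 * ((max s 0 / γ - max t 0 / γ) * (g (Q t) - g (Q s))) := by
      nlinarith
    have h4 : (max s 0 / γ - max t 0 / γ) * (g (Q t) - g (Q s)) ≤ |s - t| / γ * g x := by
      refine (le_abs_self _).trans ?_
      rw [abs_mul, ← sub_div, abs_div, abs_of_pos hγ]
      refine mul_le_mul ?_ ?_ (abs_nonneg _) (by positivity)
      · refine div_le_div_of_nonneg_right ?_ hγ.le
        exact abs_max_sub_max_le_abs s t 0
      · rw [abs_le]; constructor <;> linarith [hgle s, hgle t, hg0 (Q s), hg0 (Q t)]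
    linarith
  have hQc : Continuous Q := by
    rw [continuous_iff_continuousAt]
    intro t
    have hT : Tendsto (fun s => √(2 * (|s - t| / γ * g x))) (𝓝 t) (𝓝 0) := by
      have : ContinuousAt (fun s => √(2 * (|s - t| / γ * g x))) t := by fun_prop
      simpa [ContinuousAt] using this
    rw [ContinuousAt, tendsto_iff_dist_tendsto_zero]
    refine squeeze_zero (fun _ => dist_nonneg) (fun s => ?_) hT
    rw [Real.dist_eq]
    exact Real.abs_le_sqrt (hholder s t)
  have hgc : Continuous g := by
    rw [← continuousOn_univ]
    exact hg.continuousOn isOpen_univ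
  refine ⟨fun t => g (Q t), hgc.comp hQc, hanti, by simp [hQdef], fun t ht => by simp [hQdef, ht]⟩

lemma aux_proxE {f : ℝ → EReal} (hbot : ∀ x, f x ≠ ⊥) {γ x p : ℝ} (hγ : 0 < γ)
    (hp : IsProx1 (fun y => (γ : EReal) * f y) x p) {y : ℝ} (hy : f y ≠ ⊤) :
    f p ≠ ⊤ ∧ γ * (f p).toReal + (1/2) * (p - x)^2 ≤ γ * (f y).toReal + (1/2) * (y - x)^2 := by
  have h := hp y
  simp only at h
  rw [← EReal.coe_toReal hy (hbot y)] at h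
  have hpt : f p ≠ ⊤ := by
    intro hc
    rw [hc, EReal.coe_mul_top_of_pos hγ, EReal.top_add_coe] at h
    have h' : (⊤ : EReal) ≤ ((γ * (f y).toReal + (1/2) * (y - x)^2 : ℝ) : EReal) := by
      exact_mod_cast h
    exact absurd (top_le_iff.mp h') (EReal.coe_ne_top _)
  refine ⟨hpt, ?_⟩
  rw [← EReal.coe_toReal hpt (hbot p)] at h
  exact_mod_cast h

/-- if `ρ + γφ*(|m|/γ) > γL₀`, then there is a unique `θ > 0` with
`θ + γF′(θ) − ρ − γφ*(Prox_{(θ/γ)φ*}(|m|/γ)) = 0`, and it satisfies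
`Prox_{γF}(ρ) ≤ θ ≤ Prox_{γF}(ρ + γφ*(|m|/γ))`. -/
theorem exists_unique_root_R
    (d : ℕ) (hd : 1 ≤ d)
    (φ : ℝ → EReal) (φ' : ℝ → ℝ)
    (hbot : ∀ x, φ x ≠ ⊥)
    (hproper : ∃ x, φ x ≠ ⊤)
    (heven : ∀ x, φ (-x) = φ x)
    (hconv : ∀ x y t : ℝ, 0 ≤ t → t ≤ 1 →
      φ (t * x + (1 - t) * y) ≤ (t : EReal) * φ x + ((1 - t : ℝ) : EReal) * φ y)
    (hlsc : LowerSemicontinuous φ)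
    (hdiff : ∀ x ∈ interior {x : ℝ | φ x ≠ ⊤}, HasDerivAt (fun y => (φ y).toReal) (φ' x) x)
    (hzero : ∀ x, φ x = 0 ↔ x = 0)
    (hcase :
      ({x : ℝ | φ x ≠ ⊤} = Set.univ ∧ Tendsto φ' atBot atBot ∧ Tendsto φ' atTop atTop) ∨
      (∃ a : ℝ, 0 < a ∧ {x : ℝ | φ x ≠ ⊤} = Set.Icc (-a) a ∧
        Tendsto φ' (𝓝[>] (-a)) atBot ∧ Tendsto φ' (𝓝[<] a) atTop))
    (F : ℝ → EReal) (F' : ℝ → ℝ)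
    (hFbot : ∀ x, F x ≠ ⊥)
    (hFlsc : LowerSemicontinuous F)
    (hFconv : ∀ x y t : ℝ, 0 ≤ t → t ≤ 1 →
      F (t * x + (1 - t) * y) ≤ (t : EReal) * F x + ((1 - t : ℝ) : EReal) * F y)
    (hFdom : interior {x : ℝ | F x ≠ ⊤} = Set.Ioi 0)
    (hFdiff : ∀ x : ℝ, 0 < x → HasDerivAt (fun y => (F y).toReal) (F' x) x)
    (L₀ : EReal) (hL0top : L₀ ≠ ⊤)
    (hL0 : Tendsto (fun ξ : ℝ => (F' ξ : EReal)) (𝓝[>] 0) (𝓝 L₀))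
    (γ : ℝ) (hγ : 0 < γ) (ρ : ℝ) (m : EuclideanSpace ℝ (Fin d))
    -- `P t = Prox_{(t/γ)φ*}(|m|/γ)` for `t > 0`
    (P : ℝ → ℝ)
    (hP : ∀ t : ℝ, 0 < t →
      IsProx1 (fun y => ((t / γ : ℝ) : EReal) * fconj φ y) (‖m‖ / γ) (P t))
    (hcond : (γ : EReal) * L₀ < (ρ : EReal) + (γ : EReal) * fconj φ (‖m‖ / γ)) :
    (∃! θ : ℝ, 0 < θ ∧ θ + γ * F' θ - ρ - γ * (fconj φ (P θ)).toReal = 0) ∧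
    (∀ θ : ℝ, 0 < θ → θ + γ * F' θ - ρ - γ * (fconj φ (P θ)).toReal = 0 →
      ∀ a b : ℝ, IsProx1 (fun y => (γ : EReal) * F y) ρ a →
        IsProx1 (fun y => (γ : EReal) * F y) (ρ + γ * (fconj φ (‖m‖ / γ)).toReal) b →
        a ≤ θ ∧ θ ≤ b) := by
  have hφ0 : φ 0 = 0 := (hzero 0).2 rfl
  have hφc := aux_convexOn φ hbot hconv
  have hφnn : ∀ ξ, φ ξ ≠ ⊤ → 0 ≤ (φ ξ).toReal := by
    intro ξ hξ
    have h := hφc.2 hξ (show -ξ ∈ {x : ℝ | φ x ≠ ⊤} by simpa [heven] using hξ)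
      (by norm_num : (0:ℝ) ≤ 1/2) (by norm_num : (0:ℝ) ≤ 1/2) (by norm_num)
    simp only [smul_eq_mul, heven] at h
    rw [show (1/2 : ℝ) * ξ + 1/2 * -ξ = 0 by ring, hφ0] at h
    simp only [EReal.toReal_zero] at h
    linarith
  have hb : ∀ s : ℝ, ∃ C : ℝ, ∀ ξ, φ ξ ≠ ⊤ → s * ξ - (φ ξ).toReal ≤ C := by
    intro s
    rcases hcase with ⟨hD, h1, h2⟩ | ⟨a, ha, hD, -, -⟩
    · obtain ⟨u, hu⟩ := (h1.eventually_le_atBot s).exists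
      obtain ⟨v, hv⟩ := (h2.eventually_ge_atTop s).exists
      have hmem : ∀ z, z ∈ {x : ℝ | φ x ≠ ⊤} := by intro z; rw [hD]; trivial
      have hd' : ∀ z, HasDerivAt (fun y => (φ y).toReal) (φ' z) z := by
        intro z; apply hdiff; rw [hD, interior_univ]; trivial
      have hnu := hφnn u (hmem u)
      have hnv := hφnn v (hmem v)
      have B : ∀ ξ, |ξ| ≤ |u| + |v| → s * ξ ≤ |s| * (|u| + |v|) := fun ξ hξ =>
        (le_abs_self _).trans (by rw [abs_mul]; gcongr)
      refine ⟨|s| * (|u| + |v|), fun ξ hξ => ?_⟩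
      rcases le_total v ξ with hc | hc
      · have ht := aux_tangent hφc (hmem v) hξ (hd' v)
        have hB := B v (by linarith [abs_nonneg u])
        nlinarith [mul_nonneg (sub_nonneg.2 hv) (sub_nonneg.2 hc)]
      rcases le_total ξ u with hc' | hc'
      · have ht := aux_tangent hφc (hmem u) hξ (hd' u)
        have hB := B u (by linarith [abs_nonneg v])
        nlinarith [mul_nonneg (sub_nonneg.2 hu) (sub_nonneg.2 hc')]
      · have hB := B ξ (by
          rw [abs_le]
          constructor <;> linarith [neg_abs_le u, le_abs_self v, abs_nonneg u, abs_nonneg v])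
        linarith [hφnn ξ hξ]
    · refine ⟨|s| * a, fun ξ hξ => ?_⟩
      have hm : ξ ∈ Set.Icc (-a) a := by rw [← hD]; exact hξ
      have h3 : s * ξ ≤ |s| * a := (le_abs_self _).trans (by
        rw [abs_mul]; gcongr; exact abs_le.2 hm)
      linarith [hφnn ξ hξ]
  obtain ⟨g, hg, hg0, hgc⟩ := aux_conj_s6 φ hbot hφ0 hb
  simp only [hg, EReal.toReal_coe] at hP hcond ⊢
  set x := ‖m‖ / γ with hx
  have hP' : ∀ t : ℝ, 0 < t → ∀ y, t / γ * g (P t) + (1/2) * (P t - x)^2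
      ≤ t / γ * g y + (1/2) * (y - x)^2 := by
    intro t ht y
    have := hP t ht y
    simp only at this
    exact_mod_cast this
  obtain ⟨G, hGc, hGa, hG0, hGP⟩ := aux_Gcont hgc hg0 hγ P hP'
  have hGx : ∀ t, 0 < t → G t ≤ g x := fun t ht => hG0 ▸ hGa ht.le
  have hGnn : ∀ t, 0 < t → 0 ≤ G t := fun t ht => by rw [hGP t ht]; exact hg0 _
  have hFc := aux_convexOn F hFbot hFconv
  have hFm : ∀ t : ℝ, 0 < t → t ∈ {x : ℝ | F x ≠ ⊤} := fun t ht =>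
    interior_subset (by rw [hFdom]; exact ht)
  have hFmono : ∀ s t : ℝ, 0 < s → s ≤ t → F' s ≤ F' t := by
    intro s t hs hst
    rcases hst.eq_or_lt with rfl | hst
    · exact le_rfl
    have h1 := aux_tangent hFc (hFm s hs) (hFm t (hs.trans hst)) (hFdiff s hs)
    have h2 := aux_tangent hFc (hFm t (hs.trans hst)) (hFm s hs) (hFdiff t (hs.trans hst))
    by_contra hc
    push Not at hc
    nlinarith [mul_pos (sub_pos.2 hc) (sub_pos.2 hst)]
  have hR : ∀ s t : ℝ, 0 < s → s < t →
      s + γ * F' s - ρ - γ * G s < t + γ * F' t - ρ - γ * G t := by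
    intro s t hs hst
    have h1 := mul_le_mul_of_nonneg_left (hFmono s t hs hst.le) hγ.le
    have h2 := mul_le_mul_of_nonneg_left (hGa hst.le) hγ.le
    linarith
  -- a point with negative value
  obtain ⟨u, hu0, hu⟩ : ∃ u : ℝ, 0 < u ∧ u + γ * F' u - ρ - γ * G u < 0 := by
    have hc1 : L₀ < (((ρ + γ * g x) / γ : ℝ) : EReal) := by
      induction L₀ using EReal.rec with
      | bot => exact EReal.bot_lt_coe _
      | top => exact absurd rfl hL0top
      | coe l =>
        have : γ * l < ρ + γ * g x := by exact_mod_cast hcond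
        rw [EReal.coe_lt_coe_iff, lt_div_iff₀ hγ]
        linarith
    obtain ⟨c, hc, hc'⟩ := EReal.lt_iff_exists_real_btwn.1 hc1
    rw [EReal.coe_lt_coe_iff, lt_div_iff₀ hγ] at hc'
    have e1 : ∀ᶠ t in 𝓝[>] (0 : ℝ), (F' t : EReal) < c := hL0.eventually_lt_const hc
    have e2 : ∀ᶠ t in 𝓝[>] (0 : ℝ), t - γ * G t < ρ - γ * c := by
      have : Tendsto (fun t => t - γ * G t) (𝓝 0) (𝓝 (0 - γ * G 0)) :=
        (show Continuous (fun t => t - γ * G t) by fun_prop).tendsto 0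
      refine (this.eventually_lt_const ?_).filter_mono nhdsWithin_le_nhds
      rw [hG0]; linarith
    obtain ⟨t, h1, h2, h3⟩ := (e1.and (e2.and self_mem_nhdsWithin)).exists
    refine ⟨t, h3, ?_⟩
    have h1' : F' t < c := by exact_mod_cast h1
    have := mul_lt_mul_of_pos_left h1' hγ
    linarith
  obtain ⟨v, huv, hv⟩ : ∃ v : ℝ, u < v ∧ 0 < v + γ * F' v - ρ - γ * G v := by
    refine ⟨max (u + 1) (ρ + γ * g x - γ * F' u + 1), by
      linarith [le_max_left (u + 1) (ρ + γ * g x - γ * F' u + 1)], ?_⟩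
    set w := max (u + 1) (ρ + γ * g x - γ * F' u + 1)
    have h1 : u + 1 ≤ w := le_max_left _ _
    have h2 : ρ + γ * g x - γ * F' u + 1 ≤ w := le_max_right _ _
    have h3 := mul_le_mul_of_nonneg_left (hFmono u w hu0 (by linarith)) hγ.le
    have h4 := mul_le_mul_of_nonneg_left (hGx w (by linarith)) hγ.le
    linarith
  have hder : ∀ t ∈ Set.Icc u v, HasDerivWithinAt
      (fun t => t ^ 2 / 2 + γ * (F t).toReal - ρ * t - γ * ∫ s in (0:ℝ)..t, G s)
      ((fun t => t + γ * F' t - ρ - γ * G t) t) (Set.Icc u v) t := by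
    intro t ht
    have htp : 0 < t := hu0.trans_le ht.1
    apply HasDerivAt.hasDerivWithinAt
    have h1 := (hFdiff t htp).const_mul γ
    have h2 := ((hGc.integral_hasStrictDerivAt 0 t).hasDerivAt).const_mul γ
    have h3 := ((hasDerivAt_id t).pow 2).div_const 2
    have h4 := (hasDerivAt_id t).const_mul ρ
    have h5 := ((h3.add h1).sub h4).sub h2
    convert h5 using 1
    · ext z; simp
    · simp
  obtain ⟨θ, hθm, hθ⟩ := exists_hasDerivWithinAt_eq_of_gt_of_lt huv.le hder hu hv
  have hθ0 : 0 < θ := hu0.trans hθm.1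
  refine ⟨⟨θ, ⟨hθ0, by rw [← hGP θ hθ0]; exact hθ⟩, ?_⟩, ?_⟩
  · rintro t ⟨ht, he⟩
    rw [← hGP t ht] at he
    simp only at hθ
    rcases lt_trichotomy t θ with h | h | h
    · linarith [hR t θ ht h]
    · exact h
    · linarith [hR θ t hθ0 h]
  · intro t ht he a b ha hb'
    rw [← hGP t ht] at he
    obtain ⟨ha1, ha2⟩ := aux_proxE hFbot hγ ha (hFm t ht)
    obtain ⟨hb1, hb2⟩ := aux_proxE hFbot hγ hb' (hFm t ht)
    have ta := mul_le_mul_of_nonneg_left (aux_tangent hFc (hFm t ht) ha1 (hFdiff t ht)) hγ.le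
    have tb := mul_le_mul_of_nonneg_left (aux_tangent hFc (hFm t ht) hb1 (hFdiff t ht)) hγ.le
    have q1 := mul_nonneg hγ.le (hGnn t ht)
    have q2 := mul_le_mul_of_nonneg_left (hGx t ht) hγ.le
    constructor
    · by_contra hc
      push Not at hc
      have k : 0 ≤ (a - t) * (γ * F' t + t - ρ) := mul_nonneg (by linarith) (by linarith)
      nlinarith [mul_pos (sub_pos.2 hc) (sub_pos.2 hc)]
    · by_contra hc
      push Not at hc
      have k : 0 ≤ (t - b) * (ρ + γ * g x - γ * F' t - t) := mul_nonneg (by linarith) (by linarith)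
      nlinarith [mul_pos (sub_pos.2 hc) (sub_pos.2 hc)]
end

section
/- Let φ : ℝ → (−∞,+∞] be proper, even, convex, lower semicontinuous, differentiable on the interior of its domain, with φ(ξ) = 0 if and only if ξ = 0, and satisfying either (i) dom φ = ℝ with φ′(ξ) → ±∞ as ξ → ±∞, or (ii) dom φ = [−a, a] for some a > 0 with φ′(ξ) → ±∞ as ξ → ±a. Let F : ℝ → (−∞,+∞] be lower semicontinuous convex with interior of dom F equal to (0,+∞), F differentiable on (0,+∞), and L₀ := lim_{ξ↓0} F′(ξ) ∈ ℝ. Let Φ be the perspective function of φ∘|·| (Φ(ρ,m) = ρ·φ(|m|/ρ) for ρ > 0, Φ(0,0) = 0, +∞ otherwise), and Ψ(ρ,m) = F(ρ). Then for every γ > 0 and every (ρ,m) ∈ ℝ × ℝ^d, the point (0,0) is the unique minimizer of (σ,u) ↦ γ(Φ(σ,u) + Ψ(σ,u)) + (1/2)|(σ,u) − (ρ,m)|² if and only if ρ + γφ*(|m|/γ) ≤ γL₀. -/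
open Filter Topology

-- The perspective function of `φ ∘ |·|` on `ℝ × ℝ^d`.
open scoped Classical in
noncomputable def persp {d : ℕ} (φ : ℝ → EReal) (p : ℝ × EuclideanSpace ℝ (Fin d)) : EReal :=
  if 0 < p.1 then (p.1 : EReal) * φ (‖p.2‖ / p.1)
  else if p.1 = 0 ∧ p.2 = 0 then 0 else ⊤

-- `IsProxP f x z` : `z` is a minimizer of `y ↦ f y + (1/2)|y - x|²` (Euclidean norm on ℝ × ℝ^d).
def IsProxP {d : ℕ} (f : ℝ × EuclideanSpace ℝ (Fin d) → EReal)
    (x z : ℝ × EuclideanSpace ℝ (Fin d)) : Prop :=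
  ∀ y : ℝ × EuclideanSpace ℝ (Fin d),
    f z + (((1/2) * ((z.1 - x.1)^2 + ‖z.2 - x.2‖^2) : ℝ) : EReal) ≤
      f y + (((1/2) * ((y.1 - x.1)^2 + ‖y.2 - x.2‖^2) : ℝ) : EReal)

theorem aux_real {t a b : ℝ} {x y z : EReal} (hx : x = a) (hy : y = b) (hzb : z ≠ ⊥) (s : ℝ)
    (h : z ≤ (t : EReal) * x + (s : EReal) * y) : z.toReal ≤ t * a + s * b := by
  subst hx; subst hy
  have h2 : z ≤ ((t * a + s * b : ℝ) : EReal) := by push_cast; exact h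
  have := EReal.toReal_le_toReal h2 hzb (EReal.coe_ne_top _)
  rwa [EReal.toReal_coe] at this

theorem F_convexOn (F : ℝ → EReal) (S : Set ℝ) (hS : Convex ℝ S)
    (hFbot : ∀ x, F x ≠ ⊥) (hfin : ∀ x ∈ S, F x ≠ ⊤)
    (hFconv : ∀ x y t : ℝ, 0 ≤ t → t ≤ 1 →
      F (t * x + (1 - t) * y) ≤ (t : EReal) * F x + ((1 - t : ℝ) : EReal) * F y) :
    ConvexOn ℝ S (fun y => (F y).toReal) := by
  refine ⟨hS, ?_⟩
  intro x hx y hy a b ha hb hab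
  have hb' : b = 1 - a := by linarith
  subst hb'
  exact aux_real (EReal.coe_toReal (hfin x hx) (hFbot x)).symm
    (EReal.coe_toReal (hfin y hy) (hFbot y)).symm (hFbot _) _
    (hFconv x y a ha (by linarith))

theorem F_facts (F : ℝ → EReal) (F' : ℝ → ℝ)
    (hFbot : ∀ x, F x ≠ ⊥)
    (hFlsc : LowerSemicontinuous F)
    (hFconv : ∀ x y t : ℝ, 0 ≤ t → t ≤ 1 →
      F (t * x + (1 - t) * y) ≤ (t : EReal) * F x + ((1 - t : ℝ) : EReal) * F y)
    (hFdom : interior {x : ℝ | F x ≠ ⊤} = Set.Ioi 0)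
    (hFdiff : ∀ x : ℝ, 0 < x → HasDerivAt (fun y => (F y).toReal) (F' x) x)
    (L₀ : ℝ)
    (hL0 : Tendsto F' (𝓝[>] 0) (𝓝 L₀)) :
    ∃ G : ℝ → ℝ, (∀ x, 0 ≤ x → F x = (G x : EReal)) ∧
      (∀ x, 0 < x → G 0 + L₀ * x ≤ G x) ∧ (∀ x, 0 < x → G x ≤ G 0 + F' x * x) := by
  have hfin : ∀ x ∈ Set.Ioi (0:ℝ), F x ≠ ⊤ := by
    intro x hx
    rw [← hFdom] at hx
    exact interior_subset hx
  set G : ℝ → ℝ := fun y => (F y).toReal with hG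
  have hcv := F_convexOn F _ (convex_Ioi 0) hFbot hfin hFconv
  have tan : ∀ x e, 0 < e → e < x → G e + F' e * (x - e) ≤ G x := by
    intro x e he hex
    have := hcv.le_slope_of_hasDerivAt (x := e) (y := x) he (he.trans hex) hex (hFdiff e he)
    rw [slope_def_field, le_div_iff₀ (by linarith)] at this
    change F' e * (x - e) ≤ G x - G e at this
    linarith
  have low : ∀ (c : ℝ) (x : ℝ), 0 < x → (c : EReal) < F 0 → c + L₀ * x ≤ G x := by
    intro c x hx hc
    have h1 : ∀ᶠ e in 𝓝[>] (0:ℝ), (c : EReal) < F e :=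
      (hFlsc 0 c hc).filter_mono nhdsWithin_le_nhds
    have h2 : Tendsto (fun e => c + F' e * (x - e)) (𝓝[>] (0:ℝ)) (𝓝 (c + L₀ * (x - 0))) := by
      refine tendsto_const_nhds.add (hL0.mul (tendsto_const_nhds.sub ?_))
      exact tendsto_id.mono_left nhdsWithin_le_nhds
    rw [sub_zero] at h2
    refine le_of_tendsto h2 ?_
    filter_upwards [h1, Ioo_mem_nhdsGT hx] with e he1 he2
    have := tan x e he2.1 he2.2
    have h3 : c < G e := by
      rw [← EReal.coe_toReal (hfin e he2.1) (hFbot e)] at he1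
      exact_mod_cast he1
    linarith
  have h0 : F 0 ≠ ⊤ := by
    intro h
    have := low (G 1 - L₀ + 1) 1 one_pos (by rw [h]; exact EReal.coe_lt_top _)
    linarith
  have hfin' : ∀ x ∈ Set.Ici (0:ℝ), F x ≠ ⊤ := by
    intro x hx
    rcases (Set.mem_Ici.1 hx).eq_or_lt with h | h
    · rw [← h]; exact h0
    · exact hfin x h
  have hcv' := F_convexOn F _ (convex_Ici 0) hFbot hfin' hFconv
  have hFG : ∀ x, 0 ≤ x → F x = (G x : EReal) := fun x hx =>
    (EReal.coe_toReal (hfin' x hx) (hFbot x)).symm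
  refine ⟨G, hFG, ?_, ?_⟩
  · intro x hx
    by_contra hlt
    push Not at hlt
    have := low ((G 0 + (G x - L₀ * x)) / 2) x hx (by
      rw [hFG 0 le_rfl, EReal.coe_lt_coe_iff]; linarith)
    linarith
  · intro x hx
    have := hcv'.slope_le_of_hasDerivAt (x := 0) (y := x) Set.self_mem_Ici hx.le hx (hFdiff x hx)
    rw [slope_def_field, div_le_iff₀ (by linarith)] at this
    change G x - G 0 ≤ F' x * (x - 0) at this
    linarith

/-- with `L₀ ∈ ℝ`, the point `(0,0)` is the unique minimizer of
`(σ,u) ↦ γ(Φ(σ,u) + Ψ(σ,u)) + (1/2)|(σ,u) − (ρ,m)|²` if and only if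
`ρ + γφ*(|m|/γ) ≤ γL₀`. -/
theorem prox_is_zero_iff
    (d : ℕ) (hd : 1 ≤ d)
    (φ : ℝ → EReal) (φ' : ℝ → ℝ)
    (hbot : ∀ x, φ x ≠ ⊥)
    (hproper : ∃ x, φ x ≠ ⊤)
    (heven : ∀ x, φ (-x) = φ x)
    (hconv : ∀ x y t : ℝ, 0 ≤ t → t ≤ 1 →
      φ (t * x + (1 - t) * y) ≤ (t : EReal) * φ x + ((1 - t : ℝ) : EReal) * φ y)
    (hlsc : LowerSemicontinuous φ)
    (hdiff : ∀ x ∈ interior {x : ℝ | φ x ≠ ⊤}, HasDerivAt (fun y => (φ y).toReal) (φ' x) x)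
    (hzero : ∀ x, φ x = 0 ↔ x = 0)
    (hcase :
      ({x : ℝ | φ x ≠ ⊤} = Set.univ ∧ Tendsto φ' atBot atBot ∧ Tendsto φ' atTop atTop) ∨
      (∃ a : ℝ, 0 < a ∧ {x : ℝ | φ x ≠ ⊤} = Set.Icc (-a) a ∧
        Tendsto φ' (𝓝[>] (-a)) atBot ∧ Tendsto φ' (𝓝[<] a) atTop))
    (F : ℝ → EReal) (F' : ℝ → ℝ)
    (hFbot : ∀ x, F x ≠ ⊥)
    (hFlsc : LowerSemicontinuous F)
    (hFconv : ∀ x y t : ℝ, 0 ≤ t → t ≤ 1 →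
      F (t * x + (1 - t) * y) ≤ (t : EReal) * F x + ((1 - t : ℝ) : EReal) * F y)
    (hFdom : interior {x : ℝ | F x ≠ ⊤} = Set.Ioi 0)
    (hFdiff : ∀ x : ℝ, 0 < x → HasDerivAt (fun y => (F y).toReal) (F' x) x)
    (L₀ : ℝ)
    (hL0 : Tendsto F' (𝓝[>] 0) (𝓝 L₀))
    (γ : ℝ) (hγ : 0 < γ) (ρ : ℝ) (m : EuclideanSpace ℝ (Fin d)) :
    (IsProxP (fun z => (γ : EReal) * (persp φ z + F z.1)) (ρ, m) (0, 0) ∧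
      ∀ z, IsProxP (fun z => (γ : EReal) * (persp φ z + F z.1)) (ρ, m) z → z = (0, 0))
    ↔ (ρ : EReal) + (γ : EReal) * fconj φ (‖m‖ / γ) ≤ ((γ * L₀ : ℝ) : EReal) := by
  obtain ⟨G, hFG, hlow, hup⟩ := F_facts F F' hFbot hFlsc hFconv hFdom hFdiff L₀ hL0
  have v0 : (γ : EReal) * (persp φ ((0, 0) : ℝ × EuclideanSpace ℝ (Fin d)) + F 0)
      = ((γ * G 0 : ℝ) : EReal) := by
    rw [hFG 0 le_rfl]; simp [persp]
  have vtop : ∀ z : ℝ × EuclideanSpace ℝ (Fin d), persp φ z = ⊤ →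
      (γ : EReal) * (persp φ z + F z.1) = ⊤ := by
    intro z hz
    rw [hz, EReal.top_add_of_ne_bot (hFbot _), EReal.coe_mul_top_of_pos hγ]
  have vpos : ∀ (z : ℝ × EuclideanSpace ℝ (Fin d)) (c : ℝ), 0 < z.1 → φ (‖z.2‖ / z.1) = c →
      (γ : EReal) * (persp φ z + F z.1) = ((γ * (z.1 * c + G z.1) : ℝ) : EReal) := by
    intro z c hz hc
    rw [hFG _ hz.le]; simp [persp, hz, hc]
  constructor
  · rintro ⟨hmin, -⟩
    -- unit vector
    obtain ⟨e, he, hem⟩ : ∃ e : EuclideanSpace ℝ (Fin d), ‖e‖ = 1 ∧ inner ℝ e m = ‖m‖ := by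
      by_cases hm : m = 0
      · refine ⟨EuclideanSpace.single ⟨0, hd⟩ 1, by simp, by simp [hm]⟩
      · have hm' : ‖m‖ ≠ 0 := norm_ne_zero_iff.2 hm
        refine ⟨‖m‖⁻¹ • m, by rw [norm_smul]; simp [hm'], ?_⟩
        rw [real_inner_smul_left, real_inner_self_eq_norm_sq]; field_simp
    have key : ∀ ξ c : ℝ, 0 ≤ ξ → φ ξ = c → ρ + ‖m‖ * ξ - γ * c ≤ γ * L₀ := by
      intro ξ c hξ hc
      have h1 : ∀ s : ℝ, 0 < s → ρ + ‖m‖ * ξ - γ * c ≤ γ * F' s + s / 2 * (1 + ξ ^ 2) := by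
        intro s hs
        have h := hmin (s, (s * ξ) • e)
        have hn : ‖(s * ξ) • e‖ = s * ξ := by
          rw [norm_smul, he, mul_one, Real.norm_of_nonneg (by positivity)]
        have hq : ‖(s * ξ) • e‖ / s = ξ := by rw [hn]; field_simp
        beta_reduce at h
        rw [v0, vpos (s, (s * ξ) • e) c hs (by simpa only [hq] using hc),
          ← EReal.coe_add, ← EReal.coe_add, EReal.coe_le_coe_iff] at h
        simp only [zero_sub, norm_neg] at h
        rw [norm_sub_sq_real, hn, real_inner_smul_left, hem] at h
        have h2 := mul_le_mul_of_nonneg_left (hup s hs) hγ.le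
        have h3 : s * (ρ + ‖m‖ * ξ - γ * c) ≤ s * (γ * F' s + s / 2 * (1 + ξ ^ 2)) := by
          nlinarith
        exact le_of_mul_le_mul_left h3 hs
      have h2 : Tendsto (fun s => γ * F' s + s / 2 * (1 + ξ ^ 2)) (𝓝[>] (0:ℝ))
          (𝓝 (γ * L₀ + 0 / 2 * (1 + ξ ^ 2))) := by
        refine (hL0.const_mul γ).add (Tendsto.mul_const _ (Tendsto.div_const ?_ _))
        exact tendsto_id.mono_left nhdsWithin_le_nhds
      have h3 := ge_of_tendsto h2 (by
        filter_upwards [self_mem_nhdsWithin] with s hs using h1 s hs)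
      linarith
    have hs : fconj φ (‖m‖ / γ) ≤ (((γ * L₀ - ρ) / γ : ℝ) : EReal) := by
      refine iSup_le fun ξ => ?_
      by_cases ht : φ ξ = ⊤
      · rw [ht]; simp
      · have hc : φ ξ = ((φ ξ).toReal : EReal) := (EReal.coe_toReal ht (hbot ξ)).symm
        have hc' : φ |ξ| = ((φ ξ).toReal : EReal) := by
          rcases abs_choice ξ with h | h <;> rw [h]
          · exact hc
          · rw [heven]; exact hc
        have hk := key |ξ| _ (abs_nonneg _) hc'
        rw [hc, ← EReal.coe_sub, EReal.coe_le_coe_iff, le_div_iff₀ hγ]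
        have : (‖m‖ / γ * ξ - (φ ξ).toReal) * γ = ‖m‖ * ξ - γ * (φ ξ).toReal := by
          field_simp
        rw [this]
        have := mul_le_mul_of_nonneg_left (le_abs_self ξ) (norm_nonneg m)
        linarith
    calc (ρ : EReal) + (γ : EReal) * fconj φ (‖m‖ / γ)
        ≤ (ρ : EReal) + (γ : EReal) * (((γ * L₀ - ρ) / γ : ℝ) : EReal) := by
          gcongr
      _ = ((γ * L₀ : ℝ) : EReal) := by
          rw [← EReal.coe_mul, ← EReal.coe_add]
          congr 1
          field_simp
          ring
  · intro h
    have key : ∀ ξ c : ℝ, φ ξ = c → ρ + ‖m‖ * ξ - γ * c ≤ γ * L₀ := by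
      intro ξ c hc
      have h1 : ((‖m‖ / γ * ξ - c : ℝ) : EReal) ≤ fconj φ (‖m‖ / γ) := by
        have := le_iSup (fun ξ : ℝ => ((‖m‖ / γ * ξ : ℝ) : EReal) - φ ξ) ξ
        beta_reduce at this
        rw [hc, ← EReal.coe_sub] at this
        exact this
      have h2 : (ρ : EReal) + (γ : EReal) * ((‖m‖ / γ * ξ - c : ℝ) : EReal)
          ≤ ((γ * L₀ : ℝ) : EReal) := by
        refine le_trans ?_ h
        gcongr
      rw [← EReal.coe_mul, ← EReal.coe_add, EReal.coe_le_coe_iff] at h2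
      have : γ * (‖m‖ / γ * ξ - c) = ‖m‖ * ξ - γ * c := by field_simp
      linarith
    have strict : ∀ z : ℝ × EuclideanSpace ℝ (Fin d), z ≠ (0, 0) →
        (γ : EReal) * (persp φ ((0, 0) : ℝ × EuclideanSpace ℝ (Fin d)) + F 0) +
          (((1/2) * ((0 - ρ)^2 + ‖(0 : EuclideanSpace ℝ (Fin d)) - m‖^2) : ℝ) : EReal) <
        (γ : EReal) * (persp φ z + F z.1) +
          (((1/2) * ((z.1 - ρ)^2 + ‖z.2 - m‖^2) : ℝ) : EReal) := by
      intro z hz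
      rw [v0, ← EReal.coe_add]
      by_cases htop : persp φ z = ⊤
      · rw [vtop z htop, EReal.top_add_coe]; exact EReal.coe_lt_top _
      have hpos : 0 < z.1 := by
        by_contra hn
        apply htop
        have : ¬ (z.1 = 0 ∧ z.2 = 0) := fun h' => hz (Prod.ext h'.1 h'.2)
        simp [persp, hn, this]
      have ht : φ (‖z.2‖ / z.1) ≠ ⊤ := by
        intro h'
        apply htop
        simp [persp, hpos, h', EReal.coe_mul_top_of_pos hpos]
      obtain ⟨c, hc⟩ : ∃ c : ℝ, φ (‖z.2‖ / z.1) = c :=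
        ⟨_, (EReal.coe_toReal ht (hbot _)).symm⟩
      rw [vpos z c hpos hc, ← EReal.coe_add, EReal.coe_lt_coe_iff, zero_sub, zero_sub, norm_neg,
        norm_sub_sq_real]
      have h1 := mul_le_mul_of_nonneg_left (key _ c hc) hpos.le
      have h2 : z.1 * (ρ + ‖m‖ * (‖z.2‖ / z.1) - γ * c)
          = z.1 * ρ + ‖m‖ * ‖z.2‖ - z.1 * γ * c := by field_simp
      have h3 := mul_le_mul_of_nonneg_left (hlow _ hpos) hγ.le
      have h4 := real_inner_le_norm z.2 m
      have h5 : 0 < z.1 ^ 2 := by positivity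
      have h6 := sq_nonneg ‖z.2‖
      nlinarith
    refine ⟨?_, ?_⟩
    · intro z
      by_cases hz : z = (0, 0)
      · rw [hz]
      · exact (strict z hz).le
    · intro z hz
      by_contra hne
      exact absurd (hz (0, 0)) (not_le.2 (strict z hne))
end

section
/- Fix α, k, γ > 0 and define Φ^{α,k}_c(ρ,m) = (k²/α)(ρ − √(ρ² − |m/k|²)) if |m/k| ≤ ρ and +∞ otherwise. Fix (ρ,m) ∈ ℝ × ℝ^d. If ρ + √((γk²/α)² + k²|m|²) − γk²/α ≤ 0, then (0,0) is the unique minimizer of (σ,u) ↦ γΦ^{α,k}_c(σ,u) + (1/2)|(σ,u) − (ρ,m)|². If instead ρ + √((γk²/α)² + k²|m|²) − γk²/α > 0, then the unique minimizer is (θ,v), where θ ≥ max{0,ρ} is the unique solution of R^c(t) = 0 with R^c(t) = (((1+k²)t − ρ + γk²/α)/(t − ρ + γk²/α))·√((t − ρ + γk²/α)² − (γk²/α)²) − k|m|, and v = (θk² / ((1+k²)θ − ρ + γk²/α))·m. -/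
open Filter Topology
open scoped Classical

-- The relativistic perspective cost `Φ^{α,k}_c`.
noncomputable def PhiRelC {d : ℕ} (α k : ℝ) (p : ℝ × EuclideanSpace ℝ (Fin d)) : EReal :=
  if ‖p.2‖ / k ≤ p.1 then
    (((k^2 / α) * (p.1 - Real.sqrt (p.1^2 - (‖p.2‖ / k)^2)) : ℝ) : EReal)
  else ⊤

theorem aux_real_s13 (c k a B n σ w q N : ℝ) (hk : 0 < k) (hB : 0 ≤ B) (hn : 0 ≤ n)
    (hdom : n / k ≤ σ) (hc : 0 < c) (hN : N = Real.sqrt (c^2 + k^2 * B^2)) (hNa : N ≤ c - a)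
    (hw : w = Real.sqrt (σ^2 - (n / k)^2)) (hq : q ≤ B * n) :
    a * σ + q ≤ c * (σ - w) := by
  have hs : 0 ≤ n / k := by positivity
  have hσ : 0 ≤ σ := hs.trans hdom
  have hw0 : 0 ≤ w := hw ▸ Real.sqrt_nonneg _
  have hN0 : 0 ≤ N := hN ▸ Real.sqrt_nonneg _
  have hw2 : w^2 = σ^2 - (n/k)^2 := by
    rw [hw, Real.sq_sqrt]; nlinarith
  have hN2 : N^2 = c^2 + k^2*B^2 := by
    rw [hN, Real.sq_sqrt]; positivity
  have hns : n = k * (n / k) := by field_simp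
  set s := n / k
  have h1 : c * w + (k*B) * s ≤ N * σ := by
    apply abs_le_of_sq_le_sq' _ (by positivity) |>.2
    have : (N*σ)^2 = (c^2 + k^2*B^2) * (w^2 + s^2) := by
      rw [mul_pow, hN2, hw2]; ring
    rw [this]
    nlinarith [sq_nonneg (c * s - k*B*w)]
  have h2 : N * σ ≤ (c - a) * σ := mul_le_mul_of_nonneg_right hNa hσ
  have h3 : B * n = k * B * s := by rw [hns]; ring
  nlinarith

theorem PhiRelC_dom {d : ℕ} (α k γ : ℝ) (p : ℝ × EuclideanSpace ℝ (Fin d))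
    (h : ‖p.2‖ / k ≤ p.1) :
    (γ : EReal) * PhiRelC α k p
      = ((γ * k^2 / α * (p.1 - Real.sqrt (p.1^2 - (‖p.2‖ / k)^2)) : ℝ) : EReal) := by
  unfold PhiRelC
  rw [if_pos h, ← EReal.coe_mul]
  congr 1
  ring

theorem PhiRelC_ndom {d : ℕ} (α k γ : ℝ) (hγ : 0 < γ) (p : ℝ × EuclideanSpace ℝ (Fin d))
    (h : ¬ ‖p.2‖ / k ≤ p.1) :
    (γ : EReal) * PhiRelC α k p = ⊤ := by
  unfold PhiRelC
  rw [if_neg h]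
  exact EReal.coe_mul_top_of_pos hγ

theorem aux_prox_s13 {d : ℕ} (α k γ : ℝ) (hα : 0 < α) (hk : 0 < k) (hγ : 0 < γ)
    (ρ : ℝ) (m : EuclideanSpace ℝ (Fin d)) (θ : ℝ) (v : EuclideanSpace ℝ (Fin d))
    (hdom : ‖v‖ / k ≤ θ)
    (hC : Real.sqrt ((γ * k^2 / α)^2 + k^2 * ‖m - v‖^2) ≤ γ * k^2 / α - (ρ - θ))
    (heq : γ * k^2 / α * (θ - Real.sqrt (θ^2 - (‖v‖ / k)^2))
      = (ρ - θ) * θ + inner ℝ (m - v) v) :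
    IsProxP (fun z => (γ : EReal) * PhiRelC α k z) (ρ, m) (θ, v) ∧
        ∀ z, IsProxP (fun z => (γ : EReal) * PhiRelC α k z) (ρ, m) z → z = (θ, v) := by
  have key : ∀ y : ℝ × EuclideanSpace ℝ (Fin d), ‖y.2‖ / k ≤ y.1 →
      γ * k^2 / α * (θ - Real.sqrt (θ^2 - (‖v‖ / k)^2))
        + (1/2) * ((θ - ρ)^2 + ‖v - m‖^2) + (1/2) * ((y.1 - θ)^2 + ‖y.2 - v‖^2)
      ≤ γ * k^2 / α * (y.1 - Real.sqrt (y.1^2 - (‖y.2‖ / k)^2))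
        + (1/2) * ((y.1 - ρ)^2 + ‖y.2 - m‖^2) := by
    rintro ⟨σ, u⟩ hy
    simp only at hy ⊢
    have h := aux_real_s13 (γ * k^2 / α) k (ρ - θ) ‖m - v‖ ‖u‖ σ _ (inner ℝ (m - v) u) _ hk
      (norm_nonneg _) (norm_nonneg _) hy (by positivity) rfl hC rfl (real_inner_le_norm _ _)
    have e : ‖u - m‖^2 = ‖u - v‖^2 + ‖v - m‖^2 - 2 * (inner ℝ (m - v) u - inner ℝ (m - v) v) := by
      have : u - m = (u - v) - (m - v) := by abel
      rw [this, norm_sub_sq_real, norm_sub_rev v m, ← inner_sub_right, real_inner_comm]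
      ring
    rw [heq, e]
    nlinarith
  constructor
  · intro y
    by_cases hy : ‖y.2‖ / k ≤ y.1
    · simp only
      rw [PhiRelC_dom _ _ _ _ hy, PhiRelC_dom α k γ (θ, v) hdom, ← EReal.coe_add, ← EReal.coe_add,
        EReal.coe_le_coe_iff]
      have := key y hy
      simp only
      nlinarith [sq_nonneg (y.1 - θ), sq_nonneg ‖y.2 - v‖]
    · simp only
      rw [PhiRelC_ndom _ _ _ hγ _ hy, EReal.top_add_coe]
      exact le_top
  · intro z hz
    have h := hz (θ, v)
    by_cases hy : ‖z.2‖ / k ≤ z.1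
    · simp only at h
      rw [PhiRelC_dom _ _ _ _ hy, PhiRelC_dom α k γ (θ, v) hdom, ← EReal.coe_add, ← EReal.coe_add,
        EReal.coe_le_coe_iff] at h
      have := key z hy
      simp only at h
      have h1 : (z.1 - θ)^2 = 0 := by nlinarith [sq_nonneg (z.1 - θ), sq_nonneg ‖z.2 - v‖]
      have h2 : ‖z.2 - v‖^2 = 0 := by nlinarith [sq_nonneg (z.1 - θ), sq_nonneg ‖z.2 - v‖]
      have h3 := pow_eq_zero_iff (two_ne_zero) |>.1 h1
      have h4 := pow_eq_zero_iff (two_ne_zero) |>.1 h2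
      rw [norm_eq_zero] at h4
      exact Prod.ext (sub_eq_zero.1 h3) (sub_eq_zero.1 h4)
    · simp only at h
      rw [PhiRelC_ndom _ _ _ hγ _ hy, EReal.top_add_coe, PhiRelC_dom α k γ (θ, v) hdom,
        ← EReal.coe_add, top_le_iff] at h
      exact absurd h (EReal.coe_ne_top _)

theorem aux_mono (c k ρ s t : ℝ) (hc : 0 < c) (hs0 : 0 ≤ s) (hsρ : ρ ≤ s) (hst : s < t) :
    (((1 + k^2) * s - ρ + c) / (s - ρ + c)) * Real.sqrt ((s - ρ + c)^2 - c^2)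
    < (((1 + k^2) * t - ρ + c) / (t - ρ + c)) * Real.sqrt ((t - ρ + c)^2 - c^2) := by
  have hA : 0 < s - ρ + c := by linarith
  have hB : 0 < t - ρ + c := by linarith
  have e : ∀ x : ℝ, 0 < x - ρ + c →
      (((1 + k^2) * x - ρ + c) / (x - ρ + c)) * Real.sqrt ((x - ρ + c)^2 - c^2)
      = Real.sqrt ((x - ρ + c)^2 - c^2) + k^2 * (x * Real.sqrt (1 - (c / (x - ρ + c))^2)) := by
    intro x hx
    have : Real.sqrt (1 - (c / (x - ρ + c))^2)
        = Real.sqrt ((x - ρ + c)^2 - c^2) / (x - ρ + c) := by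
      rw [← Real.sqrt_sq hx.le, ← Real.sqrt_div' _ (by positivity), Real.sqrt_sq hx.le]
      congr 1
      field_simp
    rw [this]
    field_simp
    ring
  rw [e s hA, e t hB]
  have h1 : Real.sqrt ((s - ρ + c)^2 - c^2) < Real.sqrt ((t - ρ + c)^2 - c^2) := by
    apply Real.sqrt_lt_sqrt <;> nlinarith
  have h2 : Real.sqrt (1 - (c / (s - ρ + c))^2) ≤ Real.sqrt (1 - (c / (t - ρ + c))^2) := by
    apply Real.sqrt_le_sqrt
    gcongr
  have h3 : k^2 * (s * Real.sqrt (1 - (c / (s - ρ + c))^2))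
      ≤ k^2 * (t * Real.sqrt (1 - (c / (t - ρ + c))^2)) := by
    have ht0 : 0 ≤ t := hs0.trans hst.le
    gcongr
  linarith

theorem aux_exists (c k ρ M : ℝ) (hc : 0 < c) (hk : 0 < k) (hM : 0 ≤ M)
    (h : 0 < ρ + (Real.sqrt (c^2 + k^2 * M^2) - c)) :
    ∃ θ, max 0 ρ ≤ θ ∧
      (((1 + k^2) * θ - ρ + c) / (θ - ρ + c)) * Real.sqrt ((θ - ρ + c)^2 - c^2) = k * M := by
  set f : ℝ → ℝ := fun x =>
    (((1 + k^2) * x - ρ + c) / (x - ρ + c)) * Real.sqrt ((x - ρ + c)^2 - c^2) with hf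
  have h0 : f (max 0 ρ) ≤ k * M := by
    rcases le_total ρ 0 with hρ | hρ
    · rw [max_eq_left hρ]
      have hA : 0 < 0 - ρ + c := by linarith
      have : f 0 = Real.sqrt ((0 - ρ + c)^2 - c^2) := by
        simp only [hf]
        rw [mul_zero, div_self hA.ne', one_mul]
      rw [this, Real.sqrt_le_left (by positivity)]
      have h1 : 0 - ρ + c ≤ Real.sqrt (c^2 + k^2 * M^2) := by linarith
      rw [Real.le_sqrt hA.le (by positivity)] at h1
      nlinarith
    · rw [max_eq_right hρ]
      have : f ρ = 0 := by simp [hf]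
      rw [this]; positivity
  have hb : max 0 ρ ≤ max 0 ρ + k * M := by
    have : 0 ≤ k * M := by positivity
    linarith
  have h1 : k * M ≤ f (max 0 ρ + k * M) := by
    have hx0 : 0 ≤ max 0 ρ := le_max_left _ _
    have hxρ : ρ ≤ max 0 ρ := le_max_right _ _
    have hkM : 0 ≤ k * M := by positivity
    set x := max 0 ρ + k * M with hx
    have hA : 0 < x - ρ + c := by linarith
    have h2 : k * M ≤ Real.sqrt ((x - ρ + c)^2 - c^2) := by
      apply Real.le_sqrt_of_sq_le
      nlinarith
    have h3 : 1 ≤ ((1 + k^2) * x - ρ + c) / (x - ρ + c) := by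
      rw [le_div_iff₀ hA]
      nlinarith [mul_nonneg (sq_nonneg k) (hx0.trans hb)]
    calc k * M ≤ 1 * Real.sqrt ((x - ρ + c)^2 - c^2) := by rw [one_mul]; exact h2
      _ ≤ _ := mul_le_mul_of_nonneg_right h3 (Real.sqrt_nonneg _)
  have hcont : ContinuousOn f (Set.Icc (max 0 ρ) (max 0 ρ + k * M)) := by
    apply ContinuousOn.mul
    · apply ContinuousOn.div (by fun_prop) (by fun_prop)
      intro x hx
      have := (le_max_right 0 ρ).trans hx.1
      have : 0 < x - ρ + c := by linarith
      exact this.ne'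
    · fun_prop
  obtain ⟨θ, hθ, he⟩ := intermediate_value_Icc hb hcont ⟨h0, h1⟩
  exact ⟨θ, hθ.1, he⟩

/-- formula for `Prox_{γΦ^{α,k}_c}(ρ,m)`. If
`ρ + √((γk²/α)² + k²|m|²) − γk²/α ≤ 0` the prox is `(0,0)`; otherwise it is `(θ,v)` where
`θ ≥ max{0,ρ}` is the unique root of `R^c` and
`v = (θk²/((1+k²)θ − ρ + γk²/α))·m`. -/
theorem prox_relativistic
    (d : ℕ) (hd : 1 ≤ d)
    (α k γ : ℝ) (hα : 0 < α) (hk : 0 < k) (hγ : 0 < γ)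
    (ρ : ℝ) (m : EuclideanSpace ℝ (Fin d))
    (Rc : ℝ → ℝ)
    (hRc : ∀ t : ℝ, Rc t =
      (((1 + k^2) * t - ρ + γ * k^2 / α) / (t - ρ + γ * k^2 / α)) *
        Real.sqrt ((t - ρ + γ * k^2 / α)^2 - (γ * k^2 / α)^2) - k * ‖m‖) :
    ((ρ + (Real.sqrt ((γ * k^2 / α)^2 + k^2 * ‖m‖^2) - γ * k^2 / α) ≤ 0) →
      (IsProxP (fun z => (γ : EReal) * PhiRelC α k z) (ρ, m) (0, 0) ∧
        ∀ z, IsProxP (fun z => (γ : EReal) * PhiRelC α k z) (ρ, m) z → z = (0, 0))) ∧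
    ((0 < ρ + (Real.sqrt ((γ * k^2 / α)^2 + k^2 * ‖m‖^2) - γ * k^2 / α)) →
      ∃ θ : ℝ, max 0 ρ ≤ θ ∧ Rc θ = 0 ∧ (∀ t : ℝ, max 0 ρ ≤ t → Rc t = 0 → t = θ) ∧
        IsProxP (fun z => (γ : EReal) * PhiRelC α k z) (ρ, m)
          (θ, (θ * k^2 / ((1 + k^2) * θ - ρ + γ * k^2 / α)) • m) ∧
        ∀ z, IsProxP (fun z => (γ : EReal) * PhiRelC α k z) (ρ, m) z →
          z = (θ, (θ * k^2 / ((1 + k^2) * θ - ρ + γ * k^2 / α)) • m)) := by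
  have hc : 0 < γ * k^2 / α := by positivity
  constructor
  · intro h
    apply aux_prox_s13 α k γ hα hk hγ
    · simp
    · rw [sub_zero]; linarith
    · simp
  · intro h
    obtain ⟨θ, hθ, he⟩ := aux_exists _ k ρ ‖m‖ hc hk (norm_nonneg _) h
    have hθ0 : 0 ≤ θ := (le_max_left _ _).trans hθ
    have hθρ : ρ ≤ θ := (le_max_right _ _).trans hθ
    refine ⟨θ, hθ, by rw [hRc, he, sub_self], ?_, ?_⟩
    · intro t ht hR
      rw [hRc] at hR
      have ht0 : 0 ≤ t := (le_max_left _ _).trans ht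
      have htρ : ρ ≤ t := (le_max_right _ _).trans ht
      rcases lt_trichotomy t θ with hlt | hlt | hlt
      · have := aux_mono (γ * k^2 / α) k ρ t θ hc ht0 htρ hlt
        linarith
      · exact hlt
      · have := aux_mono (γ * k^2 / α) k ρ θ t hc hθ0 hθρ hlt
        linarith
    · clear hRc
      have hD' : (1 + k^2) * θ - ρ + γ * k^2 / α = (θ - ρ + γ * k^2 / α) + k^2 * θ := by ring
      have hA : γ * k^2 / α ≤ θ - ρ + γ * k^2 / α := by linarith
      have hA' : ρ - θ = γ * k^2 / α - (θ - ρ + γ * k^2 / α) := by ring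
      rw [hD'] at he ⊢
      have main : ∀ c A : ℝ, c = γ * k^2 / α → A = θ - ρ + γ * k^2 / α → 
          ‖(θ * k^2 / (A + k^2 * θ)) • m‖ / k ≤ θ ∧
          Real.sqrt (c^2 + k^2 * ‖m - (θ * k^2 / (A + k^2 * θ)) • m‖^2) ≤ c - (c - A) ∧
          c * (θ - Real.sqrt (θ^2 - (‖(θ * k^2 / (A + k^2 * θ)) • m‖ / k)^2))
          = (c - A) * θ +
            inner ℝ (m - (θ * k^2 / (A + k^2 * θ)) • m) ((θ * k^2 / (A + k^2 * θ)) • m) := by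
        intro c A hcc hAA
        rw [← hAA, ← hcc] at he
        rw [← hAA, ← hcc] at hA
        rw [← hcc] at hc
        have hA0 : 0 < A := by linarith
        have hD : 0 < A + k^2 * θ := by positivity
        have hS : (Real.sqrt (A^2 - c^2))^2 = A^2 - c^2 := Real.sq_sqrt (by nlinarith)
        have hS0 := Real.sqrt_nonneg (A^2 - c^2)
        set S := Real.sqrt (A^2 - c^2)
        set D := A + k^2 * θ with hDdef
        have hkm : k * ‖m‖ * A = D * S := by
          rw [← he]; field_simp
        have hm : ‖m‖ = D * S / (k * A) := by
          rw [← hkm]; field_simp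
        have hsub : m - (θ * k^2 / D) • m = (A / D) • m := by
          have : A / D = 1 - θ * k^2 / D := by
            field_simp; rw [hDdef]; ring
          rw [this, sub_smul, one_smul]
        have hnv : ‖(θ * k^2 / D) • m‖ / k = θ * S / A := by
          rw [norm_smul, Real.norm_of_nonneg (by positivity), hm]
          field_simp
        have hnb : ‖(A / D) • m‖ = S / k := by
          rw [norm_smul, Real.norm_of_nonneg (by positivity), hm]
          field_simp
        have hSA : S ≤ A := by
          apply abs_le_of_sq_le_sq' _ hA0.le |>.2
          nlinarith
        rw [hsub, hnv, hnb]
        refine ⟨?_, ?_, ?_⟩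
        · rw [div_le_iff₀ hA0]; gcongr
        · have : c^2 + k^2 * (S / k)^2 = A^2 := by
            rw [div_pow, hS]; field_simp; ring
          rw [this, Real.sqrt_sq hA0.le]; linarith
        · have : θ^2 - (θ * S / A)^2 = (θ * c / A)^2 := by
            rw [div_pow, mul_pow, hS]; field_simp; ring
          rw [this, Real.sqrt_sq (by positivity), real_inner_smul_left, real_inner_smul_right,
            real_inner_self_eq_norm_sq, hm]
          have : A / D * (θ * k^2 / D * (D * S / (k * A))^2) = θ * S^2 / A := by
            field_simp
          rw [this, hS]
          field_simp
          ring
      obtain ⟨m1, m2, m3⟩ := main _ _ rfl rfl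
      rw [← hA'] at m2 m3
      exact aux_prox_s13 α k γ hα hk hγ ρ m θ _ m1 m2 m3
end

section
/- Fix α, γ > 0 and define Φ̂_c : ℝ × ℝ^d → (−∞,+∞] by Φ̂_c(ρ,m) = |m|²/(2αρ) if ρ > 0, Φ̂_c(0,0) = 0, and +∞ otherwise. Fix (ρ,m) ∈ ℝ × ℝ^d. If ρ + α|m|²/(2γ) ≤ 0, then (0,0) is the unique minimizer of (σ,u) ↦ γΦ̂_c(σ,u) + (1/2)|(σ,u) − (ρ,m)|². If instead ρ + α|m|²/(2γ) > 0, then the unique minimizer is (θ, (θ/(θ + γ/α))·m), where θ ≥ max{0,ρ} is the unique solution of the cubic equation (t + γ/α)²(t − ρ) = γ|m|²/(2α). -/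
open Filter Topology
open scoped Classical

-- The quadratic perspective cost `Φ̂_c(ρ,m) = |m|²/(2αρ)`.
noncomputable def PhiHat {d : ℕ} (α : ℝ) (p : ℝ × EuclideanSpace ℝ (Fin d)) : EReal :=
  if 0 < p.1 then ((‖p.2‖^2 / (2 * α * p.1) : ℝ) : EReal)
  else if p.1 = 0 ∧ p.2 = 0 then 0 else ⊤

lemma phi_lower {d : ℕ} (α γ : ℝ) (hα : 0 < α) (hγ : 0 < γ) (q : ℝ)
    (p : EuclideanSpace ℝ (Fin d)) (h : α * ‖p‖^2 + 2 * γ * q ≤ 0)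
    (y : ℝ × EuclideanSpace ℝ (Fin d)) :
    ((inner ℝ p y.2 + q * y.1 : ℝ) : EReal) ≤ (γ : EReal) * PhiHat α y := by
  unfold PhiHat
  split_ifs with h1 h2
  · rw [← EReal.coe_mul, EReal.coe_le_coe_iff]
    have h3 := real_inner_le_norm p y.2
    have h4 : 0 < 2 * α * y.1 := by positivity
    rw [← mul_div_assoc, le_div_iff₀ h4]
    have h5 : 0 ≤ (α * y.1 * ‖p‖ - γ * ‖y.2‖)^2 := sq_nonneg _
    have h6 : inner ℝ p y.2 * (2 * α * y.1) ≤ ‖p‖ * ‖y.2‖ * (2 * α * y.1) :=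
      mul_le_mul_of_nonneg_right h3 h4.le
    have h7 : (α * ‖p‖^2 + 2 * γ * q) * (α * y.1 ^ 2) ≤ 0 :=
      mul_nonpos_of_nonpos_of_nonneg h (by positivity)
    refine le_of_mul_le_mul_left ?_ hγ
    nlinarith [mul_le_mul_of_nonneg_left h6 hγ.le]
  · simp [h2.1, h2.2]
  · rw [EReal.coe_mul_top_of_pos hγ]
    exact le_top

lemma prox_of_sub {d : ℕ} (f : ℝ × EuclideanSpace ℝ (Fin d) → EReal)
    (x z : ℝ × EuclideanSpace ℝ (Fin d))
    (hz : f z = ((inner ℝ (x.2 - z.2) z.2 + (x.1 - z.1) * z.1 : ℝ) : EReal))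
    (hf : ∀ y, ((inner ℝ (x.2 - z.2) y.2 + (x.1 - z.1) * y.1 : ℝ) : EReal) ≤ f y) :
    IsProxP f x z ∧ ∀ y, IsProxP f x y → y = z := by
  have key : ∀ y : ℝ × EuclideanSpace ℝ (Fin d),
      (inner ℝ (x.2 - z.2) z.2 + (x.1 - z.1) * z.1)
        + ((1/2) * ((z.1 - x.1)^2 + ‖z.2 - x.2‖^2))
        + (1/2) * ((y.1 - z.1)^2 + ‖y.2 - z.2‖^2)
      = (inner ℝ (x.2 - z.2) y.2 + (x.1 - z.1) * y.1)
        + ((1/2) * ((y.1 - x.1)^2 + ‖y.2 - x.2‖^2)) := by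
    intro y
    simp only [norm_sub_sq_real, inner_sub_left, real_inner_self_eq_norm_sq]
    rw [real_inner_comm x.2 z.2, real_inner_comm x.2 y.2, real_inner_comm z.2 y.2]
    ring
  refine ⟨fun y => ?_, fun y hy => ?_⟩
  · refine le_trans ?_ (add_le_add_left (hf y) _)
    rw [hz, ← EReal.coe_add, ← EReal.coe_add, EReal.coe_le_coe_iff, ← key y]
    have : 0 ≤ (1/2) * ((y.1 - z.1)^2 + ‖y.2 - z.2‖^2) := by positivity
    linarith
  · have h1 := le_trans (add_le_add_left (hf y) _) (hy z)
    rw [hz, ← EReal.coe_add, ← EReal.coe_add, EReal.coe_le_coe_iff, ← key y] at h1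
    have h2 : (y.1 - z.1)^2 = 0 := by nlinarith [sq_nonneg (y.1 - z.1), sq_nonneg ‖y.2 - z.2‖]
    have h3 : ‖y.2 - z.2‖^2 = 0 := by nlinarith [sq_nonneg (y.1 - z.1), sq_nonneg ‖y.2 - z.2‖]
    refine Prod.ext ?_ ?_
    · exact sub_eq_zero.1 (pow_eq_zero_iff two_ne_zero |>.1 h2)
    · exact sub_eq_zero.1 (norm_eq_zero.1 (pow_eq_zero_iff two_ne_zero |>.1 h3))

/-- formula for `Prox_{γΦ̂_c}(ρ,m)`. If `ρ + α|m|²/(2γ) ≤ 0` the prox is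
`(0,0)`; otherwise it is `(θ, (θ/(θ + γ/α))·m)` where `θ ≥ max{0,ρ}` is the unique root of
the cubic `(t + γ/α)²(t − ρ) = γ|m|²/(2α)`. -/
theorem prox_quadratic_perspective
    (d : ℕ) (hd : 1 ≤ d)
    (α γ : ℝ) (hα : 0 < α) (hγ : 0 < γ)
    (ρ : ℝ) (m : EuclideanSpace ℝ (Fin d)) :
    ((ρ + α * ‖m‖^2 / (2 * γ) ≤ 0) →
      (IsProxP (fun z => (γ : EReal) * PhiHat α z) (ρ, m) (0, 0) ∧
        ∀ z, IsProxP (fun z => (γ : EReal) * PhiHat α z) (ρ, m) z → z = (0, 0))) ∧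
    ((0 < ρ + α * ‖m‖^2 / (2 * γ)) →
      ∃ θ : ℝ, max 0 ρ ≤ θ ∧ (θ + γ / α)^2 * (θ - ρ) = γ * ‖m‖^2 / (2 * α) ∧
        (∀ t : ℝ, max 0 ρ ≤ t → (t + γ / α)^2 * (t - ρ) = γ * ‖m‖^2 / (2 * α) → t = θ) ∧
        IsProxP (fun z => (γ : EReal) * PhiHat α z) (ρ, m) (θ, (θ / (θ + γ / α)) • m) ∧
        ∀ z, IsProxP (fun z => (γ : EReal) * PhiHat α z) (ρ, m) z →
          z = (θ, (θ / (θ + γ / α)) • m)) := by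
  have hc : 0 < γ / α := by positivity
  refine ⟨fun h => ?_, fun h => ?_⟩
  · apply prox_of_sub
    · simp [PhiHat]
    · intro y
      apply phi_lower α γ hα hγ
      simp only [sub_zero]
      have : α * ‖m‖^2 + 2 * γ * ρ = (ρ + α * ‖m‖^2 / (2 * γ)) * (2 * γ) := by
        field_simp
        ring
      rw [this]
      exact mul_nonpos_of_nonpos_of_nonneg h (by positivity)
  · have hcγ : γ = γ / α * α := by field_simp
    generalize hcc : γ / α = c at *
    have hK : γ * ‖m‖^2 / (2 * α) = c * ‖m‖^2 / 2 := by
      rw [hcγ]; field_simp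
    have h0 : 0 < 2 * c * ρ + ‖m‖^2 := by
      have : 2 * c * ρ + ‖m‖^2 = (ρ + α * ‖m‖^2 / (2 * γ)) * (2 * c) := by
        rw [hcγ]; field_simp
      rw [this]; positivity
    rw [hK]
    have hN : 0 ≤ ‖m‖^2 := by positivity
    have hex : ∃ θ : ℝ, max 0 ρ ≤ θ ∧ (θ + c)^2 * (θ - ρ) = c * ‖m‖^2 / 2 := by
      set B := max 0 ρ + ‖m‖^2 / (2 * c) with hB
      have hB0 : 0 ≤ ‖m‖^2 / (2 * c) := by positivity
      have hM0 : 0 ≤ max 0 ρ := le_max_left _ _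
      have hMρ : ρ ≤ max 0 ρ := le_max_right _ _
      have hle : max 0 ρ ≤ B := by linarith
      have hcont : ContinuousOn (fun t : ℝ => (t + c)^2 * (t - ρ)) (Set.Icc (max 0 ρ) B) := by
        fun_prop
      have hmem : c * ‖m‖^2 / 2 ∈ Set.Icc ((max 0 ρ + c)^2 * (max 0 ρ - ρ))
          ((B + c)^2 * (B - ρ)) := by
        constructor
        · rcases le_total 0 ρ with hρ | hρ
          · rw [max_eq_right hρ]; simp; positivity
          · rw [max_eq_left hρ]; nlinarith
        · have e1 : c * ‖m‖^2 / 2 = c^2 * (‖m‖^2 / (2 * c)) := by field_simp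
          rw [e1]
          apply mul_le_mul _ _ hB0 (by positivity)
          · apply pow_le_pow_left₀ hc.le; linarith
          · linarith
      obtain ⟨θ, h1, h2⟩ := intermediate_value_Icc hle hcont hmem
      exact ⟨θ, h1.1, h2⟩
    obtain ⟨θ, hθ, hθe⟩ := hex
    have hθ0 : 0 ≤ θ := (le_max_left _ _).trans hθ
    have hθρ : ρ ≤ θ := (le_max_right _ _).trans hθ
    have mono : ∀ a b : ℝ, max 0 ρ ≤ a → a < b → (a + c)^2 * (a - ρ) < (b + c)^2 * (b - ρ) := by
      intro a b ha hab
      have ha0 : 0 ≤ a := (le_max_left _ _).trans ha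
      have haρ : ρ ≤ a := (le_max_right _ _).trans ha
      have h1 : (a + c)^2 ≤ (b + c)^2 := by apply pow_le_pow_left₀ <;> linarith
      have h2 : 0 < (b + c)^2 := by have : 0 < b + c := by linarith
                                    positivity
      calc (a + c)^2 * (a - ρ) ≤ (b + c)^2 * (a - ρ) :=
            mul_le_mul_of_nonneg_right h1 (by linarith)
        _ < _ := mul_lt_mul_of_pos_left (by linarith) h2
    have hpos : 0 < θ := by
      rcases hθ0.lt_or_eq with h1 | h1
      · exact h1
      · rw [← h1] at hθe; nlinarith
    have hs : 0 < θ + c := by linarith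
    have hp : m - (θ / (θ + c)) • m = (c / (θ + c)) • m := by
      have : c / (θ + c) = 1 - θ / (θ + c) := by field_simp; ring
      rw [this, sub_smul, one_smul]
    have hq : ρ - θ = - (c * ‖m‖^2 / (2 * (θ + c)^2)) := by
      field_simp
      linarith
    refine ⟨θ, hθ, hθe, ?_, ?_⟩
    · intro t ht hte
      rcases lt_trichotomy t θ with h1 | h1 | h1
      · have := mono t θ ht h1; linarith
      · exact h1
      · have := mono θ t hθ h1; linarith
    · apply prox_of_sub
      · simp only [PhiHat, hpos, if_true]
        rw [← EReal.coe_mul, hp, hq, EReal.coe_eq_coe_iff, real_inner_smul_left,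
          real_inner_smul_right, real_inner_self_eq_norm_sq, norm_smul, mul_pow,
          Real.norm_eq_abs, sq_abs, hcγ]
        field_simp
        ring
      · intro y
        apply phi_lower α γ hα hγ
        simp only []
        rw [hp, hq, norm_smul, mul_pow, Real.norm_eq_abs, sq_abs, hcγ]
        apply le_of_eq
        field_simp
        ring
end
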